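/- arXiv:1508.03866 — 7 statements merged into one kernel-verified Lean document; each statement's English description precedes it below -/
import Mathlib

section
/- For every integer n ≥ 4, the graphs K_n and K_n + K_{n-1} are Ramsey equivalent: for every finite simple graph G, G is Ramsey for K_n if and only if G is Ramsey for K_n + K_{n-1}. -/
open Finset

/-- `S` is a monochromatic `K_m` in colour `b`: it has exactly `m` vertices,
its vertices are pairwise adjacent in `G`, and every edge inside `S` has colour `b`. -/
def IsMonoClique {V : Type*} (G : SimpleGraph V) (c : V → V → Bool) (b : Bool)
    (m : ℕ) (S : Finset V) : Prop :=
  S.card = m ∧ (∀ x ∈ S, ∀ y ∈ S, x ≠ y → G.Adj x y) ∧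
    (∀ x ∈ S, ∀ y ∈ S, x ≠ y → c x y = b)

/-- `G` is Ramsey for `K n`: every symmetric 2-colouring of the edges of `G`
contains a monochromatic `K n` in some colour. -/
def IsRamseyFor {V : Type*} (G : SimpleGraph V) (n : ℕ) : Prop :=
  ∀ c : V → V → Bool, (∀ x y, c x y = c y x) →
    ∃ b S, IsMonoClique G c b n S

/-- `G` is Ramsey for `K n + K m`: every symmetric 2-colouring of the edges of `G`
contains, in some colour `b`, two disjoint vertex sets that are a monochromatic `K n`
and a monochromatic `K m` in colour `b`. -/
def IsRamseyForPair {V : Type*} (G : SimpleGraph V) (n m : ℕ) : Prop :=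
  ∀ c : V → V → Bool, (∀ x y, c x y = c y x) →
    ∃ b S T, Disjoint S T ∧ IsMonoClique G c b n S ∧ IsMonoClique G c b m T

namespace IsMonoClique

variable {V : Type*} {G : SimpleGraph V} {c c' : V → V → Bool} {b : Bool} {m : ℕ} {S T : Finset V}

lemma of_subset (h : IsMonoClique G c b m S) (hT : T ⊆ S) : IsMonoClique G c b T.card T :=
  ⟨rfl, fun x hx y hy => h.2.1 x (hT hx) y (hT hy), fun x hx y hy => h.2.2 x (hT hx) y (hT hy)⟩

lemma congr_colour (h : IsMonoClique G c b m S)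
    (hc : ∀ x ∈ S, ∀ y ∈ S, x ≠ y → c x y = c' x y) : IsMonoClique G c' b m S :=
  ⟨h.1, h.2.1, fun x hx y hy hxy => (hc x hx y hy hxy).symm.trans (h.2.2 x hx y hy hxy)⟩

/-- Two vertices of a clique in one colour are not both in a clique in the other colour. -/
lemma eq_of_mem_of_mem {k : ℕ} {x y : V} (hS : IsMonoClique G c b m S)
    (hT : IsMonoClique G c (!b) k T) (hxS : x ∈ S) (hyS : y ∈ S) (hxT : x ∈ T) (hyT : y ∈ T) :
    x = y := by
  by_contra hxy
  have h1 := hS.2.2 x hxS y hyS hxy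
  have h2 := hT.2.2 x hxT y hyT hxy
  cases b <;> simp_all

end IsMonoClique

/-- The colouring `c` has no two disjoint cliques `K n` and `K (n - 1)` in colour `b`. -/
def HasNoMonoPair {V : Type*} (G : SimpleGraph V) (c : V → V → Bool) (n : ℕ) (b : Bool) : Prop :=
  ∀ S T, IsMonoClique G c b n S → IsMonoClique G c b (n - 1) T → ¬ Disjoint S T

/-- No vertex is common to all monochromatic `K n` in colour `b`. -/
def NoCommonVertex {V : Type*} (G : SimpleGraph V) (c : V → V → Bool) (n : ℕ) (b : Bool) : Prop :=
  ∀ v, ∃ S, IsMonoClique G c b n S ∧ v ∉ S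

/-- If all the cliques `K n` in colour `b` share the vertex `v`, then recolouring the edges at `v`
destroys all of them, without creating cliques on three or more vertices in the other colour. -/
lemma exists_recolouring_of_common_vertex {V : Type*} {G : SimpleGraph V} {c : V → V → Bool}
    {n : ℕ} {b : Bool} (hc : ∀ x y, c x y = c y x) (hpair : HasNoMonoPair G c n b)
    {S : Finset V} (hS : IsMonoClique G c b n S) {v : V}
    (hv : ∀ K, IsMonoClique G c b n K → v ∈ K) :
    ∃ c' : V → V → Bool, (∀ x y, c' x y = c' y x) ∧ (∀ K, ¬ IsMonoClique G c' b n K) ∧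
      ∀ m K, 3 ≤ m → IsMonoClique G c' (!b) m K → IsMonoClique G c (!b) m K := by
  classical
  let c' : V → V → Bool := fun x y =>
    if x = v then (if y ∈ S then !b else b) else
      if y = v then (if x ∈ S then !b else b) else c x y
  have hv' : ∀ y, c' v y = if y ∈ S then !b else b := fun y => by simp [c']
  have hne : ∀ x y, x ≠ v → y ≠ v → c' x y = c x y := fun x y hx hy => by simp [c', hx, hy]
  refine ⟨c', fun x y => ?_, fun K hK => ?_, fun m K hm hK => ?_⟩
  · by_cases hx : x = v <;> by_cases hy : y = v <;> simp [c', hx, hy, hc x y]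
  · by_cases hvK : v ∈ K
    · refine hpair S (K.erase v) hS ?_ ?_
      · have := (hK.of_subset (Finset.erase_subset v K)).congr_colour (c' := c)
          fun x hx y hy _ => hne x y (Finset.ne_of_mem_erase hx) (Finset.ne_of_mem_erase hy)
        rwa [Finset.card_erase_of_mem hvK, hK.1] at this
      · rw [Finset.disjoint_left]
        intro y hyS hyK
        have := hK.2.2 v hvK y (Finset.mem_of_mem_erase hyK) (Finset.ne_of_mem_erase hyK).symm
        rw [hv', if_pos hyS] at this
        cases b <;> simp at this
    · exact hvK (hv K (hK.congr_colour fun x hx y hy _ =>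
        hne x y (by rintro rfl; exact hvK hx) (by rintro rfl; exact hvK hy)))
  · by_cases hvK : v ∈ K
    · exfalso
      have hKS : ∀ y ∈ K, y ≠ v → y ∈ S := by
        intro y hy hyv
        by_contra hyS
        have := hK.2.2 v hvK y hy hyv.symm
        rw [hv', if_neg hyS] at this
        cases b <;> simp at this
      have hcard : 1 < (K.erase v).card := by
        rw [Finset.card_erase_of_mem hvK, hK.1]; omega
      obtain ⟨x, hx, y, hy, hxy⟩ := Finset.one_lt_card.1 hcard
      rw [Finset.mem_erase] at hx hy
      have h1 := hK.2.2 x hx.2 y hy.2 hxy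
      rw [hne x y hx.1 hy.1, hS.2.2 x (hKS x hx.2 hx.1) y (hKS y hy.2 hy.1) hxy] at h1
      cases b <;> simp at h1
    · exact hK.congr_colour fun x hx y hy _ =>
        hne x y (by rintro rfl; exact hvK hx) (by rintro rfl; exact hvK hy)

/-- The vertex sets that guide a recolouring destroying the cliques `K n` in colour `b`: the edges
inside `base` receive the other colour, edges leaving `base` receive colour `b`, except that the
apex sends the other colour to `core` and the vertices of `tail` send it to `base \ core`. -/
structure Gadget {V : Type*} (G : SimpleGraph V) (c : V → V → Bool) (n : ℕ) (b : Bool) where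
  base : Finset V
  core : Finset V
  tail : Finset V
  apex : V
  core_subset : core ⊆ base
  card_base : base.Nonempty → base.card = n - 1
  card_core : base.Nonempty → core.card = n - 2
  tail_colour : ∀ x ∈ tail, ∀ y ∈ tail, x ≠ y → c x y = b
  not_disjoint : ∀ K, IsMonoClique G c b n K → ¬ Disjoint K base
  apex_mem : base.Nonempty → ∀ K, IsMonoClique G c b (n - 1) K → Disjoint K base → apex ∈ K
  exists_mem_tail : base.Nonempty → ∀ K, IsMonoClique G c b (n - 1) K → Disjoint K base →
    ∃ t ∈ K, t ∈ tail ∧ t ≠ apex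

namespace Gadget

variable {V : Type*} {G : SimpleGraph V} {c : V → V → Bool} {n : ℕ} {b : Bool}

/-- The trivial gadget, in the absence of cliques `K n`. -/
def empty (v : V) (h : ∀ K, ¬ IsMonoClique G c b n K) : Gadget G c n b where
  base := ∅
  core := ∅
  tail := ∅
  apex := v
  core_subset := subset_rfl
  card_base := by simp
  card_core := by simp
  tail_colour := by simp
  not_disjoint := fun K hK => (h K hK).elim
  apex_mem := by simp
  exists_mem_tail := by simp

open Classical in
/-- The colour of an edge from a vertex `x` of the base to a vertex `y` outside. -/
noncomputable def outerColour (g : Gadget G c n b) (x y : V) : Bool :=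
  if y = g.apex then (if x ∈ g.core then !b else b)
  else if y ∈ g.tail then (if x ∈ g.core then b else !b) else b

/-- A clique `K n` in colour `b` avoiding a vertex `v` of another clique `S` gives a gadget with
base `S \ {v}`. -/
lemma exists_base_eq [DecidableEq V] (hn : 4 ≤ n) (hpair : HasNoMonoPair G c n b)
    {S T : Finset V} {v : V} (hS : IsMonoClique G c b n S) (hT : IsMonoClique G c b n T)
    (hvS : v ∈ S) (hvT : v ∉ T) : ∃ g : Gadget G c n b, g.base = S.erase v := by
  have hcard : (S.erase v).card = n - 1 := by rw [Finset.card_erase_of_mem hvS, hS.1]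
  obtain ⟨m, hm⟩ : (S.erase v).Nonempty := Finset.card_pos.1 (by omega)
  have key : ∀ K, Disjoint K (S.erase v) → v ∉ K → Disjoint S K := by
    intro K hK hv
    rw [Finset.disjoint_left] at hK ⊢
    intro x hxS hxK
    exact hK hxK (Finset.mem_erase.2 ⟨by rintro rfl; exact hv hxK, hxS⟩)
  refine ⟨⟨S.erase v, (S.erase v).erase m, T \ S, v, Finset.erase_subset _ _, fun _ => hcard,
    fun _ => by rw [Finset.card_erase_of_mem hm, hcard]; omega, ?_, ?_, ?_, ?_⟩, rfl⟩
  · intro x hx y hy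
    exact hT.2.2 x (Finset.mem_sdiff.1 hx).1 y (Finset.mem_sdiff.1 hy).1
  · intro K hK hdisj
    obtain ⟨Q, hQ, hQcard⟩ := Finset.exists_subset_card_eq (s := K.erase v) (n := n - 1)
      (by have := Finset.pred_card_le_card_erase (s := K) (a := v); rw [hK.1] at this; exact this)
    refine hpair S Q hS ?_ (key Q (hdisj.mono_left (hQ.trans (Finset.erase_subset _ _)))
      fun h => by simpa using hQ h)
    rw [← hQcard]
    exact hK.of_subset (hQ.trans (Finset.erase_subset _ _))
  · intro _ K hK hdisj
    by_contra hv
    exact hpair S K hS hK (key K hdisj hv)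
  · intro _ K hK hdisj
    obtain ⟨t, htT, htK⟩ := Finset.not_disjoint_iff.1 (hpair T K hT hK)
    have htv : t ≠ v := by rintro rfl; exact hvT htT
    refine ⟨t, htK, Finset.mem_sdiff.2 ⟨htT, fun htS => ?_⟩, htv⟩
    exact Finset.disjoint_left.1 hdisj htK (Finset.mem_erase.2 ⟨htv, htS⟩)

/-- A recolouring guided by the gadgets `g` and `g'` leaves no `K n` in the colour of `g'`. -/
lemma not_isMonoClique [DecidableEq V] (hn : 4 ≤ n) (g : Gadget G c n (!b)) (g' : Gadget G c n b)
    {c' : V → V → Bool}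
    (hbase : ∀ x ∈ g.base, ∀ y, y ∉ g.base → y ∉ g'.base → c' x y = g.outerColour x y)
    (hinner' : ∀ x ∈ g'.base, ∀ y ∈ g'.base, c' x y = !b)
    (hbase' : ∀ x ∈ g'.base, ∀ y, y ∉ g.base → y ∉ g'.base → c' x y = g'.outerColour x y)
    (hrest : ∀ x y, x ∉ g.base → x ∉ g'.base → y ∉ g.base → y ∉ g'.base → c' x y = c x y)
    (hcross : g.base.Nonempty → ∀ y ∈ g'.base, ∃ x ∈ g.core, c' x y = !b)
    (hdisj : Disjoint g.base g'.base) (K : Finset V) : ¬ IsMonoClique G c' b n K := by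
  intro hK
  have hb : b ≠ !b := by cases b <;> simp
  have hone : ∀ x ∈ K, x ∈ g'.base → ∀ y ∈ K, y ∈ g'.base → x = y := by
    intro x hx hx' y hy hy'
    by_contra hxy
    exact hb ((hK.2.2 x hx y hy hxy).symm.trans (hinner' x hx' y hy'))
  by_cases hKB : Disjoint K g.base
  · have hKB' := Finset.disjoint_left.1 hKB
    by_cases hKB2 : Disjoint K g'.base
    · have hKB2' := Finset.disjoint_left.1 hKB2
      exact g'.not_disjoint K (hK.congr_colour fun x hx y hy _ =>
        hrest x y (hKB' hx) (hKB2' hx) (hKB' hy) (hKB2' hy)) hKB2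
    · obtain ⟨z, hzK, hz⟩ := Finset.not_disjoint_iff.1 hKB2
      have hout : ∀ x ∈ K.erase z, x ∉ g.base ∧ x ∉ g'.base := by
        intro x hx
        rw [Finset.mem_erase] at hx
        exact ⟨hKB' hx.2, fun h => hx.1 (hone x hx.2 h z hzK hz)⟩
      have hQ : IsMonoClique G c b (n - 1) (K.erase z) := by
        have := (hK.of_subset (Finset.erase_subset z K)).congr_colour (c' := c)
          fun x hx y hy _ => hrest x y (hout x hx).1 (hout x hx).2 (hout y hy).1 (hout y hy).2
        rwa [Finset.card_erase_of_mem hzK, hK.1] at this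
      have hQd : Disjoint (K.erase z) g'.base :=
        Finset.disjoint_left.2 fun x hx => (hout x hx).2
      have hcol : ∀ x ∈ K.erase z, g'.outerColour z x = b := by
        intro x hx
        rw [← hbase' z hz x (hout x hx).1 (hout x hx).2]
        rw [Finset.mem_erase] at hx
        exact hK.2.2 z hzK x hx.2 hx.1.symm
      have h1 := hcol _ (g'.apex_mem ⟨z, hz⟩ _ hQ hQd)
      obtain ⟨t, htK, htT, hta⟩ := g'.exists_mem_tail ⟨z, hz⟩ _ hQ hQd
      have h2 := hcol t htK
      by_cases hzc : z ∈ g'.core <;> simp [outerColour, hzc, hta, htT] at h1 h2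
  · obtain ⟨z, hzK, hz⟩ := Finset.not_disjoint_iff.1 hKB
    have hBne : g.base.Nonempty := ⟨z, hz⟩
    have hcardB := g.card_base hBne
    have hcardM := g.card_core hBne
    have hcol : ∀ x ∈ K, x ∈ g.base → ∀ y ∈ K, y ∉ g.base → y ∉ g'.base →
        g.outerColour x y = b := by
      intro x hxK hx y hyK hy hy'
      rw [← hbase x hx y hy hy']
      exact hK.2.2 x hxK y hyK (by rintro rfl; exact hy hx)
    have hbig : n - 1 ≤ (K \ g'.base).card := by
      have h1 : (K ∩ g'.base).card ≤ 1 := Finset.card_le_one.2 fun x hx y hy => by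
        rw [Finset.mem_inter] at hx hy
        exact hone x hx.1 hx.2 y hy.1 hy.2
      have h2 := Finset.card_sdiff_add_card_inter K g'.base
      rw [hK.1] at h2
      omega
    -- A clique containing the whole core cannot be extended within the other base.
    have hcore : ∀ W : Finset V, W.card ≤ n - 1 → g.core ⊆ W → K \ g'.base ⊆ W → False := by
      intro W hW hMW hKW
      have hEq : K \ g'.base = W := Finset.eq_of_subset_of_card_le hKW (by omega)
      obtain ⟨y, hyK, hy⟩ : ∃ y ∈ K, y ∈ g'.base := by
        by_contra! hno
        rw [Finset.sdiff_eq_self_of_disjoint (Finset.disjoint_left.2 hno)] at hEq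
        have := hK.1
        rw [hEq] at this
        omega
      obtain ⟨x, hxM, hxy⟩ := hcross hBne y hy
      have hxK : x ∈ K := (Finset.mem_sdiff.1 (hEq ▸ hMW hxM)).1
      have hne : x ≠ y := by
        rintro rfl
        exact Finset.disjoint_left.1 hdisj (g.core_subset hxM) hy
      exact hb ((hK.2.2 x hxK y hyK hne).symm.trans hxy)
    by_cases htail : ∃ t ∈ K, t ∉ g.base ∧ t ∉ g'.base ∧ t ≠ g.apex
    · obtain ⟨t, htK, htB, htB', hta⟩ := htail
      have hnot : ∀ x ∈ K, x ∈ g.base → x ∉ g.core := by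
        intro x hxK hx hxM
        have := hcol x hxK hx t htK htB htB'
        by_cases h : t ∈ g.tail <;> simp [outerColour, hta, hxM, h] at this
      have hmem : ∀ y ∈ K, y ∉ g.base → y ∉ g'.base → y ∈ g.tail := by
        intro y hyK hy hy'
        have := hcol z hzK hz y hyK hy hy'
        have hzM := hnot z hzK hz
        by_contra h
        simp [outerColour, hzM, h] at this
      have hsub : K \ g'.base ⊆ (g.base \ g.core) ∪ {t} := by
        intro y hy
        rw [Finset.mem_sdiff] at hy
        by_cases hyB : y ∈ g.base
        · exact Finset.mem_union_left _ (Finset.mem_sdiff.2 ⟨hyB, hnot y hy.1 hyB⟩)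
        · refine Finset.mem_union_right _ (Finset.mem_singleton.2 ?_)
          by_contra hyt
          have h1 := g.tail_colour y (hmem y hy.1 hyB hy.2) t (hmem t htK htB htB') hyt
          rw [← hrest y t hyB hy.2 htB htB', hK.2.2 y hy.1 t htK hyt] at h1
          exact hb h1
      have h1 := Finset.card_le_card hsub
      have h2 := Finset.card_union_le (g.base \ g.core) {t}
      have h3 := Finset.card_sdiff_add_card_eq_card g.core_subset
      rw [Finset.card_singleton] at h2
      omega
    · push Not at htail
      by_cases hs : g.apex ∈ K ∧ g.apex ∉ g.base ∧ g.apex ∉ g'.base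
      · have hin : ∀ x ∈ K, x ∈ g.base → x ∈ g.core := by
          intro x hxK hx
          have := hcol x hxK hx _ hs.1 hs.2.1 hs.2.2
          by_contra h
          simp [outerColour, h] at this
        refine hcore (insert g.apex g.core) ((Finset.card_insert_le _ _).trans (by omega))
          (Finset.subset_insert _ _) fun y hy => ?_
        rw [Finset.mem_sdiff] at hy
        by_cases hyB : y ∈ g.base
        · exact Finset.mem_insert_of_mem (hin y hy.1 hyB)
        · rw [htail y hy.1 hyB hy.2]
          exact Finset.mem_insert_self _ _
      · refine hcore g.base hcardB.le g.core_subset fun y hy => ?_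
        rw [Finset.mem_sdiff] at hy
        by_contra hyB
        have := htail y hy.1 hyB hy.2
        subst this
        exact hs ⟨hy.1, hyB, hy.2⟩

/-- Two gadgets with disjoint bases give a colouring without monochromatic `K n`. -/
lemma exists_recolouring (hn : 4 ≤ n) (hc : ∀ x y, c x y = c y x) (g : Gadget G c n true)
    (g' : Gadget G c n false) (hdisj : Disjoint g.base g'.base) :
    ∃ c' : V → V → Bool, (∀ x y, c' x y = c' y x) ∧ ∀ b K, ¬ IsMonoClique G c' b n K := by
  classical
  obtain ⟨h, hh, hh'⟩ : ∃ h : V → V → Bool,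
      (g.base.Nonempty → ∀ y ∈ g'.base, ∃ x ∈ g.core, h x y = true) ∧
      (g'.base.Nonempty → ∀ x ∈ g.base, ∃ y ∈ g'.core, h x y = false) := by
    by_cases hne : g.base.Nonempty ∧ g'.base.Nonempty
    · have h1 := g.card_core hne.1
      have h2 := g'.card_core hne.2
      obtain ⟨p, hp, q, hq, hpq⟩ := Finset.one_lt_card.1 (show 1 < g.core.card by omega)
      obtain ⟨p', hp', q', hq', hpq'⟩ := Finset.one_lt_card.1 (show 1 < g'.core.card by omega)
      refine ⟨fun x y => xor (decide (x = p)) (decide (y = p')), fun _ y _ => ?_, fun _ x _ => ?_⟩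
      · by_cases hy : y = p'
        · exact ⟨q, hq, by simp [hy, hpq.symm]⟩
        · exact ⟨p, hp, by simp [hy]⟩
      · by_cases hx : x = p
        · exact ⟨p', hp', by simp [hx]⟩
        · exact ⟨q', hq', by simp [hx, hpq'.symm]⟩
    · exact ⟨fun _ _ => true, fun h1 y hy => (hne ⟨h1, y, hy⟩).elim,
        fun h1 x hx => (hne ⟨⟨x, hx⟩, h1⟩).elim⟩
  let c' : V → V → Bool := fun x y =>
    if x ∈ g.base then
      if y ∈ g.base then false else if y ∈ g'.base then h x y else g.outerColour x y
    else if x ∈ g'.base then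
      if y ∈ g.base then h y x else if y ∈ g'.base then true else g'.outerColour x y
    else
      if y ∈ g.base then g.outerColour y x else if y ∈ g'.base then g'.outerColour y x else c x y
  have hd := Finset.disjoint_left.1 hdisj
  have hd' := Finset.disjoint_right.1 hdisj
  have hsymm : ∀ x y, c' x y = c' y x := by
    intro x y
    simp only [c']
    split_ifs <;> first | rfl | exact hc x y
  have h1 : ∀ x ∈ g.base, ∀ y ∈ g.base, c' x y = false := by
    intro x hx y hy
    simp [c', hx, hy]
  have h2 : ∀ x ∈ g'.base, ∀ y ∈ g'.base, c' x y = true := by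
    intro x hx y hy
    simp [c', hx, hy, hd' hx, hd' hy]
  have h3 : ∀ x ∈ g.base, ∀ y, y ∉ g.base → y ∉ g'.base → c' x y = g.outerColour x y := by
    intro x hx y hy hy'
    simp [c', hx, hy, hy']
  have h4 : ∀ x ∈ g'.base, ∀ y, y ∉ g.base → y ∉ g'.base → c' x y = g'.outerColour x y := by
    intro x hx y hy hy'
    simp [c', hx, hd' hx, hy, hy']
  have h5 : ∀ x ∈ g.base, ∀ y ∈ g'.base, c' x y = h x y := by
    intro x hx y hy
    simp [c', hx, hy, hd' hy]
  have h6 : ∀ x y, x ∉ g.base → x ∉ g'.base → y ∉ g.base → y ∉ g'.base → c' x y = c x y := by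
    intro x y hx hx' hy hy'
    simp [c', hx, hx', hy, hy']
  refine ⟨c', hsymm, fun b K => ?_⟩
  cases b
  · refine not_isMonoClique (b := false) hn g g' h3 h2 h4 h6 (fun hne y hy => ?_) hdisj K
    obtain ⟨x, hx, hxy⟩ := hh hne y hy
    exact ⟨x, hx, (h5 x (g.core_subset hx) y hy).trans hxy⟩
  · refine not_isMonoClique (b := true) hn g' g (fun x hx y hy hy' => h4 x hx y hy' hy) h1
      (fun x hx y hy hy' => h3 x hx y hy' hy) (fun x y hx hx' hy hy' => h6 x y hx' hx hy' hy)
      (fun hne x hx => ?_) hdisj.symm K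
    obtain ⟨y, hy, hxy⟩ := hh' hne x hx
    exact ⟨y, hy, (hsymm y x).trans ((h5 x hx y (g'.core_subset hy)).trans hxy)⟩

end Gadget

section

variable {V : Type*} {G : SimpleGraph V} {c : V → V → Bool} {n : ℕ}

lemma exists_recolouring_of_noCommonVertex (hn : 4 ≤ n) (hc : ∀ x y, c x y = c y x)
    (hpair : ∀ b, HasNoMonoPair G c n b)
    (h : ∀ b, (∀ K, ¬ IsMonoClique G c b n K) ∨ NoCommonVertex G c n b) :
    ∃ c' : V → V → Bool, (∀ x y, c' x y = c' y x) ∧ ∀ b K, ¬ IsMonoClique G c' b n K := by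
  classical
  have hnonempty : ∀ {b K}, IsMonoClique G c b n K → K.Nonempty := fun hK =>
    Finset.card_pos.1 (by rw [hK.1]; omega)
  rcases isEmpty_or_nonempty V with hV | ⟨⟨v⟩⟩
  · exact ⟨c, hc, fun b K hK => by obtain ⟨x, -⟩ := hnonempty hK; exact hV.elim x⟩
  have hgadget : ∀ {b}, NoCommonVertex G c n b → ∀ S, IsMonoClique G c b n S → ∀ x ∈ S,
      ∃ g : Gadget G c n b, g.base = S.erase x := by
    intro b hb S hS x hx
    obtain ⟨T, hT, hxT⟩ := hb x
    exact Gadget.exists_base_eq hn (hpair b) hS hT hx hxT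
  rcases h true with ht | ht <;> rcases h false with hf | hf
  · exact ⟨c, hc, fun b K => by cases b <;> [exact hf K; exact ht K]⟩
  · obtain ⟨S, hS, -⟩ := hf v
    obtain ⟨x, hx⟩ := hnonempty hS
    obtain ⟨g', -⟩ := hgadget hf S hS x hx
    exact Gadget.exists_recolouring hn hc (Gadget.empty v ht) g' (Finset.disjoint_empty_left _)
  · obtain ⟨S, hS, -⟩ := ht v
    obtain ⟨x, hx⟩ := hnonempty hS
    obtain ⟨g, -⟩ := hgadget ht S hS x hx
    exact Gadget.exists_recolouring hn hc g (Gadget.empty v hf) (Finset.disjoint_empty_right _)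
  · obtain ⟨S, hS, -⟩ := ht v
    obtain ⟨R, hR, -⟩ := hf v
    obtain ⟨x, hx, hxR⟩ : ∃ x ∈ S, Disjoint (S.erase x) R := by
      by_cases hSR : Disjoint S R
      · obtain ⟨x, hx⟩ := hnonempty hS
        exact ⟨x, hx, hSR.mono_left (Finset.erase_subset _ _)⟩
      · obtain ⟨x, hxS, hxR⟩ := Finset.not_disjoint_iff.1 hSR
        refine ⟨x, hxS, Finset.disjoint_left.2 fun y hy hyR => ?_⟩
        rw [Finset.mem_erase] at hy
        exact hy.1 (hS.eq_of_mem_of_mem hR hy.2 hxS hyR hxR)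
    obtain ⟨y, hy⟩ := hnonempty hR
    obtain ⟨g, hg⟩ := hgadget ht S hS x hx
    obtain ⟨g', hg'⟩ := hgadget hf R hR y hy
    refine Gadget.exists_recolouring hn hc g g' ?_
    rw [hg, hg']
    exact hxR.mono_right (Finset.erase_subset _ _)

/-- If some vertex is common to all the cliques `K n` in colour `b`, they can be removed. -/
lemma noCommonVertex_or_exists_recolouring (hn : 4 ≤ n) (hc : ∀ x y, c x y = c y x)
    (hpair : ∀ b, HasNoMonoPair G c n b) (b : Bool) :
    NoCommonVertex G c n b ∨ ∃ c' : V → V → Bool, (∀ x y, c' x y = c' y x) ∧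
      (∀ b, HasNoMonoPair G c' n b) ∧ (∀ K, ¬ IsMonoClique G c' b n K) ∧
      ∀ K, IsMonoClique G c' (!b) n K → IsMonoClique G c (!b) n K := by
  rw [or_iff_not_imp_left]
  intro hv
  simp only [NoCommonVertex, not_forall, not_exists, not_and, not_not] at hv
  obtain ⟨v, hv⟩ := hv
  by_cases hS : ∃ S, IsMonoClique G c b n S
  · obtain ⟨S, hS⟩ := hS
    obtain ⟨c', hc', hno, hback⟩ := exists_recolouring_of_common_vertex hc (hpair b) hS hv
    refine ⟨c', hc', fun d => ?_, hno, fun K => hback n K (by omega)⟩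
    intro P Q hP hQ
    obtain rfl | rfl : d = b ∨ d = !b := by cases b <;> cases d <;> simp
    · exact (hno P hP).elim
    · exact hpair _ P Q (hback n P (by omega) hP) (hback (n - 1) Q (by omega) hQ)
  · exact ⟨c, hc, hpair, not_exists.1 hS, fun _ => id⟩

lemma exists_recolouring_of_hasNoMonoPair (hn : 4 ≤ n) (hc : ∀ x y, c x y = c y x)
    (hpair : ∀ b, HasNoMonoPair G c n b) :
    ∃ c' : V → V → Bool, (∀ x y, c' x y = c' y x) ∧ ∀ b K, ¬ IsMonoClique G c' b n K := by
  have hfree : ∀ (b : Bool) (c : V → V → Bool), (∀ x y, c x y = c y x) →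
      (∀ b, HasNoMonoPair G c n b) → (∀ K, ¬ IsMonoClique G c b n K) →
      ∃ c' : V → V → Bool, (∀ x y, c' x y = c' y x) ∧ ∀ b K, ¬ IsMonoClique G c' b n K := by
    intro b c hc hpair hb
    rcases noCommonVertex_or_exists_recolouring hn hc hpair (!b) with
      h | ⟨c', hc', hpair', hno, hback⟩
    · exact exists_recolouring_of_noCommonVertex hn hc hpair
        fun d => by cases b <;> cases d <;> simp_all
    · rw [Bool.not_not] at hback
      refine ⟨c', hc', fun d K hK => ?_⟩
      obtain rfl | rfl : d = b ∨ d = !b := by cases b <;> cases d <;> simp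
      · exact hb K (hback K hK)
      · exact hno K hK
  by_cases h : ∀ b, NoCommonVertex G c n b
  · exact exists_recolouring_of_noCommonVertex hn hc hpair fun b => Or.inr (h b)
  · obtain ⟨b, hb⟩ := not_forall.1 h
    obtain ⟨c', hc', hpair', hno, -⟩ :=
      (noCommonVertex_or_exists_recolouring hn hc hpair b).resolve_left hb
    exact hfree b c' hc' hpair' hno

end

theorem ramsey_equivalent_Kn_and_Kn_add_Knsub1 (n : ℕ) (hn : 4 ≤ n) :
    ∀ {V : Type*} [Fintype V] (G : SimpleGraph V),
      IsRamseyFor G n ↔ IsRamseyForPair G n (n - 1) := by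
  intro V _ G
  refine ⟨fun h c hc => ?_, fun h c hc => ?_⟩
  · by_contra hno
    obtain ⟨c', hc', hfree⟩ := exists_recolouring_of_hasNoMonoPair (G := G) hn hc
      fun b S T hS hT hST => hno ⟨b, S, T, hST, hS, hT⟩
    obtain ⟨b, S, hS⟩ := h c' hc'
    exact hfree b S hS
  · obtain ⟨b, S, -, -, hS, -⟩ := h c hc
    exact ⟨b, S, hS⟩
end

section
/- If a finite simple graph G is Ramsey for K_3 but not Ramsey for K_3 + K_2, then G contains the complete graph K_6 as a subgraph, i.e., G has six vertices that are pairwise adjacent. -/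
open Finset

/-- A vertex colouring with five colours yields an edge colouring without monochromatic triangles:
pull back the pentagon colouring of `K_5`. -/
theorem not_isRamseyFor_three_of_five_colors {V : Type*} {G : SimpleGraph V} (f : V → Fin 5)
    (hf : ∀ x y, G.Adj x y → f x ≠ f y) : ¬ IsRamseyFor G 3 := by
  intro h
  obtain ⟨b, S, hS, hadj, hcol⟩ := h (fun x y => decide (f x - f y = 1 ∨ f y - f x = 1))
    (fun x y => by simp only [or_comm])
  classical
  obtain ⟨x, y, z, hxy, hxz, hyz, rfl⟩ := Finset.card_eq_three.1 hS
  have key : ∀ i j k : Fin 5, ∀ b : Bool, i ≠ j → i ≠ k → j ≠ k →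
      decide (i - j = 1 ∨ j - i = 1) = b → decide (i - k = 1 ∨ k - i = 1) = b →
      decide (j - k = 1 ∨ k - j = 1) = b → False := by decide
  exact key (f x) (f y) (f z) b
    (hf _ _ (hadj x (by simp) y (by simp) hxy)) (hf _ _ (hadj x (by simp) z (by simp) hxz))
    (hf _ _ (hadj y (by simp) z (by simp) hyz)) (hcol x (by simp) y (by simp) hxy)
    (hcol x (by simp) z (by simp) hxz) (hcol y (by simp) z (by simp) hyz)

/-- A graph covered by five independent sets is not Ramsey for `K_3`. -/
theorem not_isRamseyFor_three_of_independent_cover {V : Type*} {G : SimpleGraph V}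
    {P₀ P₁ P₂ P₃ P₄ : V → Prop} (hP : ∀ x, P₀ x ∨ P₁ x ∨ P₂ x ∨ P₃ x ∨ P₄ x)
    (h : ∀ x y, G.Adj x y →
      ¬ (P₀ x ∧ P₀ y) ∧ ¬ (P₁ x ∧ P₁ y) ∧ ¬ (P₂ x ∧ P₂ y) ∧ ¬ (P₃ x ∧ P₃ y) ∧ ¬ (P₄ x ∧ P₄ y)) :
    ¬ IsRamseyFor G 3 := by
  classical
  refine not_isRamseyFor_three_of_five_colors
    (fun x => if P₀ x then 0 else if P₁ x then 1 else if P₂ x then 2 else if P₃ x then 3 else 4) ?_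
  intro x y hxy
  have := h x y hxy
  have := hP x
  have := hP y
  split_ifs <;> first | decide | (exfalso; grind)

/-- If `G` is triangle-free outside `{a, b, d}` and the common neighbours of `b` and `d` outside
`{a, b, d}` induce a bipartite graph, then `G` is not Ramsey for `K_3`. -/
theorem not_isRamseyFor_three_of_bipartite_inter {V : Type*} {G : SimpleGraph V} {a b d : V}
    (hab : a ≠ b) (had : a ≠ d) (hbd : b ≠ d) (p : V → Prop)
    (hfree : ∀ x y z, x ≠ a → x ≠ b → x ≠ d → y ≠ a → y ≠ b → y ≠ d → z ≠ a → z ≠ b → z ≠ d →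
      G.Adj x y → G.Adj x z → G.Adj y z → False)
    (hp : ∀ x y, x ≠ a → x ≠ b → x ≠ d → y ≠ a → y ≠ b → y ≠ d → G.Adj x y →
      G.Adj b x → G.Adj d x → G.Adj b y → G.Adj d y → (p x ↔ ¬ p y)) :
    ¬ IsRamseyFor G 3 := by
  intro h
  classical
  let side : V → V → Bool := fun v x =>
    if v = a then decide (x = b ∨ x = d)
    else if v = b then decide (G.Adj d x ∧ p x) else decide (G.Adj b x ∧ ¬ p x)
  let col : V → V → Bool := fun x y =>
    if x = a then side x y else if y = a then side y x
    else if x = b then (if y = d then false else side x y)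
    else if y = b then (if x = d then false else side y x)
    else if x = d then side x y else if y = d then side y x else true
  have hside : ∀ v x, side v x = if v = a then decide (x = b ∨ x = d)
    else if v = b then decide (G.Adj d x ∧ p x) else decide (G.Adj b x ∧ ¬ p x) := fun _ _ => rfl
  have hcol : ∀ x y, col x y = if x = a then side x y else if y = a then side y x
    else if x = b then (if y = d then false else side x y)
    else if y = b then (if x = d then false else side y x)
    else if x = d then side x y else if y = d then side y x else true := fun _ _ => rfl
  clear_value side col
  have hsymm : ∀ x y, col x y = col y x := by
    intro x y
    rw [hcol, hcol]
    clear hcol hside h hfree hp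
    grind
  have hca : ∀ x, x ≠ a → col a x = decide (x = b ∨ x = d) := by
    intro x hx
    simp [hcol, hside]
  have hcb : ∀ x, x ≠ a → x ≠ b → x ≠ d → col b x = decide (G.Adj d x ∧ p x) := by
    intro x hxa hxb hxd
    simp [hcol, hside, hxa, hxd, hab.symm]
  have hcd : ∀ x, x ≠ a → x ≠ b → x ≠ d → col d x = decide (G.Adj b x ∧ ¬ p x) := by
    intro x hxa hxb hxd
    simp [hcol, hside, hxa, hxb, had.symm, hbd.symm]
  have hcbd : col b d = false := by simp [hcol, hab.symm, had.symm]
  have hco : ∀ x y, x ≠ a → x ≠ b → x ≠ d → y ≠ a → y ≠ b → y ≠ d → col x y = true := by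
    intro x y hxa hxb hxd hya hyb hyd
    simp [hcol, hxa, hxb, hxd, hya, hyb, hyd]
  obtain ⟨r, S, hS, hadj, hmono⟩ := h col hsymm
  obtain ⟨x, y, z, hxy, hxz, hyz, rfl⟩ := Finset.card_eq_three.1 hS
  have axy := hadj x (by simp) y (by simp) hxy
  have axz := hadj x (by simp) z (by simp) hxz
  have ayz := hadj y (by simp) z (by simp) hyz
  have cxy := hmono x (by simp) y (by simp) hxy
  have cxz := hmono x (by simp) z (by simp) hxz
  have cyz := hmono y (by simp) z (by simp) hyz
  have ayx := axy.symm
  have azx := axz.symm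
  have azy := ayz.symm
  have cyx := (hsymm y x).trans cxy
  have czx := (hsymm z x).trans cxz
  have czy := (hsymm z y).trans cyz
  clear hadj hmono hS h hcol hside hsymm
  have htri : ∀ v, v = a ∨ v = b ∨ v = d ∨ (v ≠ a ∧ v ≠ b ∧ v ≠ d) := by grind
  have f₁ := hfree x y z
  have p₁ := hp x y
  have p₂ := hp x z
  have p₃ := hp y z
  have o₁ := hco x y
  have o₂ := hco x z
  have o₃ := hco y z
  have hx := htri x
  have hy := htri y
  have hz := htri z
  clear hfree hp htri hco
  rcases hx with rfl | rfl | rfl | hx <;> rcases hy with rfl | rfl | rfl | hy <;>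
    rcases hz with rfl | rfl | rfl | hz <;> first | contradiction | grind

/-- No monochromatic `K_3 + K_2`, in terms of vertices: every edge with the colour of a
monochromatic triangle meets that triangle. -/
def EdgesMeetTriangles {V : Type*} (G : SimpleGraph V) (c : V → V → Bool) : Prop :=
  ∀ x y z p q, G.Adj x y → G.Adj x z → G.Adj y z → c x y = c x z → c x y = c y z →
    G.Adj p q → c p q = c x y → p = x ∨ p = y ∨ p = z ∨ q = x ∨ q = y ∨ q = z

theorem edgesMeetTriangles_of_forall_not {V : Type*} {G : SimpleGraph V} {c : V → V → Bool}
    (hc : ∀ x y, c x y = c y x)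
    (h : ¬ ∃ b S T, Disjoint S T ∧ IsMonoClique G c b 3 S ∧ IsMonoClique G c b 2 T) :
    EdgesMeetTriangles G c := by
  classical
  intro x y z p q hxy hxz hyz e₁ e₂ hpq e₃
  by_contra hne
  push Not at hne
  refine h ⟨c x y, {x, y, z}, {p, q}, ?_, ⟨?_, ?_, ?_⟩, ?_, ?_, ?_⟩
  · simp [Finset.disjoint_left]
    grind
  · exact Finset.card_eq_three.2 ⟨x, y, z, hxy.ne, hxz.ne, hyz.ne, rfl⟩
  · have := hxy.symm
    have := hxz.symm
    have := hyz.symm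
    grind
  · grind
  · exact Finset.card_pair hpq.ne
  · have := hpq.symm
    grind
  · grind

/-- If all edges outside `T = {a, b, d}` have the colour other than that of the monochromatic
triangle `T`, and there is no triangle outside `T`, then `G` is not Ramsey for `K_3`. -/
theorem not_isRamseyFor_three_of_triangleFree_outside {V : Type*} {G : SimpleGraph V}
    {c : V → V → Bool} (hF : EdgesMeetTriangles G c) {a b d : V}
    (hab : G.Adj a b) (had : G.Adj a d) (hbd : G.Adj b d)
    (e₁ : c a b = c a d) (e₂ : c a b = c b d)
    (hfree : ∀ x y z, x ≠ a → x ≠ b → x ≠ d → y ≠ a → y ≠ b → y ≠ d → z ≠ a → z ≠ b → z ≠ d →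
      G.Adj x y → G.Adj x z → G.Adj y z → False) :
    ¬ IsRamseyFor G 3 := by
  intro hR
  have hout : ∀ x y, x ≠ a → x ≠ b → x ≠ d → y ≠ a → y ≠ b → y ≠ d → G.Adj x y →
      c x y ≠ c a b := by
    intro x y
    have := hF a b d x y
    grind
  -- The graph outside the triangle is not a double star, as double stars are bipartite.
  have hstar : ∀ x y, x ≠ a → x ≠ b → x ≠ d → y ≠ a → y ≠ b → y ≠ d → G.Adj x y →
      ∃ u v, (u ≠ a ∧ u ≠ b ∧ u ≠ d) ∧ (v ≠ a ∧ v ≠ b ∧ v ≠ d) ∧ G.Adj u v ∧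
        u ≠ x ∧ u ≠ y ∧ v ≠ x ∧ v ≠ y := by
    intro x y hxa hxb hxd hya hyb hyd hxy
    by_contra hno
    push Not at hno
    refine not_isRamseyFor_three_of_bipartite_inter hab.ne had.ne hbd.ne (fun u => G.Adj x u)
      hfree ?_ hR
    intro u v hua hub hud hva hvb hvd huv _ _ _ _
    have h₁ := hfree x u v hxa hxb hxd hua hub hud hva hvb hvd
    have h₂ := hno u v ⟨hua, hub, hud⟩ ⟨hva, hvb, hvd⟩ huv
    have := huv.symm
    clear hno hfree hout hF hR
    by_cases u = x <;> by_cases u = y <;> by_cases v = x <;> grind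
  have hindep : ∀ t x y, (t = a ∨ t = b ∨ t = d) → x ≠ a → x ≠ b → x ≠ d →
      y ≠ a → y ≠ b → y ≠ d → G.Adj x y → G.Adj t x → G.Adj t y →
      c t x ≠ c a b → c t y = c a b := by
    intro t x y ht hxa hxb hxd hya hyb hyd hxy htx hty h₁
    by_contra h₂
    obtain ⟨u, v, ⟨hua, hub, hud⟩, ⟨hva, hvb, hvd⟩, huv, h⟩ :=
      hstar x y hxa hxb hxd hya hyb hyd hxy
    have hmeet := hF t x y u v htx hty hxy
    have c₁ : c t x = !c a b := by simpa [Bool.eq_not] using h₁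
    have c₂ : c t y = !c a b := by simpa [Bool.eq_not] using h₂
    have c₃ : c x y = !c a b := by
      simpa [Bool.eq_not] using hout x y hxa hxb hxd hya hyb hyd hxy
    have c₄ : c u v = !c a b := by
      simpa [Bool.eq_not] using hout u v hua hub hud hva hvb hvd huv
    have := hmeet (by rw [c₁, c₂]) (by rw [c₁, c₃]) huv (by rw [c₄, c₁])
    clear hstar hout hfree hF hmeet
    grind
  -- A common neighbour of `b` and `d` spanning a triangle of the same colour.
  obtain ⟨w, hwa, hwb, hwd, hbw, hdw, cbw, cdw⟩ : ∃ w, w ≠ a ∧ w ≠ b ∧ w ≠ d ∧ G.Adj b w ∧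
      G.Adj d w ∧ c b w = c a b ∧ c d w = c a b := by
    by_contra hno
    push Not at hno
    refine not_isRamseyFor_three_of_bipartite_inter hab.ne had.ne hbd.ne
      (fun u => c b u ≠ c a b) hfree ?_ hR
    intro x y hxa hxb hxd hya hyb hyd hxy hbx hdx hby hdy
    have := hno x
    have := hno y
    have := hindep b x y
    have := hindep d x y
    grind
  have ha : ∀ x, x ≠ b → x ≠ d → x ≠ w → G.Adj a x → c a x ≠ c a b := by
    intro x
    have := hF b d w a x hbd hbw hdw
    have := hab.ne
    have := had.ne
    grind
  refine not_isRamseyFor_three_of_bipartite_inter (a := d) (b := a) (d := b)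
    had.ne.symm hbd.ne.symm hab.ne (fun u => u = w) (by grind) ?_ hR
  intro x y hxd hxa hxb hyd hya hyb hxy hax hbx hay hby
  have := ha x
  have := ha y
  have := hindep a x y
  have := hxy.ne
  grind

/-- Two disjoint monochromatic triangles of different colours. -/
structure OppositeTriangles {V : Type*} (G : SimpleGraph V) (c : V → V → Bool)
    (t₁ t₂ t₃ u₁ u₂ u₃ : V) : Prop where
  t₁₂ : G.Adj t₁ t₂
  t₁₃ : G.Adj t₁ t₃
  t₂₃ : G.Adj t₂ t₃
  u₁₂ : G.Adj u₁ u₂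
  u₁₃ : G.Adj u₁ u₃
  u₂₃ : G.Adj u₂ u₃
  ct₁ : c t₁ t₂ = c t₁ t₃
  ct₂ : c t₁ t₂ = c t₂ t₃
  cu₁ : c u₁ u₂ = c u₁ u₃
  cu₂ : c u₁ u₂ = c u₂ u₃
  ne_color : c t₁ t₂ ≠ c u₁ u₂
  disjoint : ∀ x, x = t₁ ∨ x = t₂ ∨ x = t₃ → x ≠ u₁ ∧ x ≠ u₂ ∧ x ≠ u₃

/-- No six vertices are pairwise adjacent. -/
def NoSixClique {V : Type*} (G : SimpleGraph V) : Prop :=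
  ∀ x₁ x₂ x₃ x₄ x₅ x₆,
    (G.Adj x₁ x₂ ∧ G.Adj x₁ x₃ ∧ G.Adj x₁ x₄ ∧ G.Adj x₁ x₅ ∧ G.Adj x₁ x₆) →
    (G.Adj x₂ x₃ ∧ G.Adj x₂ x₄ ∧ G.Adj x₂ x₅ ∧ G.Adj x₂ x₆) →
    (G.Adj x₃ x₄ ∧ G.Adj x₃ x₅ ∧ G.Adj x₃ x₆) → (G.Adj x₄ x₅ ∧ G.Adj x₄ x₆) → ¬ G.Adj x₅ x₆

namespace OppositeTriangles

variable {V : Type*} {G : SimpleGraph V} {c : V → V → Bool} {t₁ t₂ t₃ u₁ u₂ u₃ : V}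

theorem swap (h : OppositeTriangles G c t₁ t₂ t₃ u₁ u₂ u₃) :
    OppositeTriangles G c u₁ u₂ u₃ t₁ t₂ t₃ := by
  obtain ⟨_, _, _, _, _, _, _, _, _, _, _, _⟩ := h
  constructor <;> grind

theorem rotate (hc : ∀ x y, c x y = c y x) (h : OppositeTriangles G c t₁ t₂ t₃ u₁ u₂ u₃) :
    OppositeTriangles G c t₂ t₃ t₁ u₁ u₂ u₃ := by
  obtain ⟨h₁, h₂, _, _, _, _, _, _, _, _, _, _⟩ := h
  have := h₁.symm
  have := h₂.symm
  constructor <;> grind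

theorem swap_first (hc : ∀ x y, c x y = c y x) (h : OppositeTriangles G c t₁ t₂ t₃ u₁ u₂ u₃) :
    OppositeTriangles G c t₂ t₁ t₃ u₁ u₂ u₃ := by
  obtain ⟨h₁, _, _, _, _, _, _, _, _, _, _, _⟩ := h
  have := h₁.symm
  constructor <;> grind

theorem meets (hF : EdgesMeetTriangles G c) (h : OppositeTriangles G c t₁ t₂ t₃ u₁ u₂ u₃)
    {p q : V} (hpq : G.Adj p q) (hcol : c p q = c t₁ t₂) :
    p = t₁ ∨ p = t₂ ∨ p = t₃ ∨ q = t₁ ∨ q = t₂ ∨ q = t₃ :=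
  hF _ _ _ _ _ h.t₁₂ h.t₁₃ h.t₂₃ h.ct₁ h.ct₂ hpq hcol

theorem color_or (h : OppositeTriangles G c t₁ t₂ t₃ u₁ u₂ u₃) (p q : V) :
    c p q = c t₁ t₂ ∨ c p q = c u₁ u₂ := by
  have := h.ne_color
  revert this
  cases c p q <;> cases c t₁ t₂ <;> cases c u₁ u₂ <;> simp

/-- `x` lies on neither triangle. -/
def Outside (t₁ t₂ t₃ u₁ u₂ u₃ x : V) : Prop :=
  x ≠ t₁ ∧ x ≠ t₂ ∧ x ≠ t₃ ∧ x ≠ u₁ ∧ x ≠ u₂ ∧ x ≠ u₃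

theorem not_adj_outside (hF : EdgesMeetTriangles G c)
    (h : OppositeTriangles G c t₁ t₂ t₃ u₁ u₂ u₃) {x y : V}
    (hx : Outside t₁ t₂ t₃ u₁ u₂ u₃ x) (hy : Outside t₁ t₂ t₃ u₁ u₂ u₃ y) : ¬ G.Adj x y := by
  intro hxy
  have := h.color_or x y
  have := h.meets hF hxy
  have := h.swap.meets hF hxy
  grind [Outside]

/-- A vertex `w` off both triangles adjacent to `u₁` and `u₂` forces all edges at `u₃` that avoid
`w`, `u₁`, `u₂` to have the colour of the other triangle. -/
theorem color_of_adj (hF : EdgesMeetTriangles G c)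
    (h : OppositeTriangles G c t₁ t₂ t₃ u₁ u₂ u₃) {w x : V}
    (hw : Outside t₁ t₂ t₃ u₁ u₂ u₃ w) (h₁ : G.Adj w u₁) (h₂ : G.Adj w u₂)
    (hxw : x ≠ w) (hx₁ : x ≠ u₁) (hx₂ : x ≠ u₂) (hx : G.Adj u₃ x) :
    c u₃ x = c t₁ t₂ ∧ (x = t₁ ∨ x = t₂ ∨ x = t₃) := by
  have d₁ := h.disjoint u₁
  have d₂ := h.disjoint u₂
  have d₃ := h.disjoint u₃
  have c₁ : c w u₁ = c u₁ u₂ := by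
    have := h.color_or w u₁
    have := h.meets hF h₁
    grind [Outside]
  have c₂ : c w u₂ = c u₁ u₂ := by
    have := h.color_or w u₂
    have := h.meets hF h₂
    grind [Outside]
  have h₃ : c u₃ x = c t₁ t₂ := by
    have := h.color_or u₃ x
    have := hF w u₁ u₂ u₃ x h₁ h₂ h.u₁₂ (by rw [c₁, c₂]) c₁ hx
    have := h.u₁₃.ne
    have := h.u₂₃.ne
    grind [Outside]
  have := h.meets hF hx h₃
  grind

/-- If `u₁`, `t₁` and `u₂`, `t₃` are non-adjacent and `w` is the only possible neighbour of `u₃` off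
both triangles, then `G` is covered by five independent sets. -/
theorem not_isRamseyFor_three_of_two_not_adj (hF : EdgesMeetTriangles G c)
    (h : OppositeTriangles G c t₁ t₂ t₃ u₁ u₂ u₃) {w : V}
    (hW : ∀ x, Outside t₁ t₂ t₃ u₁ u₂ u₃ x → x ≠ w → ¬ G.Adj u₃ x)
    (ht₂ : ¬ G.Adj u₂ t₃) (hn : ¬ G.Adj u₁ t₁) : ¬ IsRamseyFor G 3 := by
  refine not_isRamseyFor_three_of_independent_cover (G := G) (P₀ := fun x => x = u₁ ∨ x = t₁)
    (P₁ := fun x => x = u₂ ∨ x = t₃) (P₂ := fun x => x = t₂) (P₃ := fun x => x = w)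
    (P₄ := fun x => x = u₃ ∨ Outside t₁ t₂ t₃ u₁ u₂ u₃ x ∧ x ≠ w) ?_ ?_
  · grind [Outside]
  intro x y hxy
  have h₁ := hxy.symm
  have h₂ := hxy.ne
  have := h.not_adj_outside hF (x := x) (y := y)
  have := hW x
  have := hW y
  clear hW hF
  refine ⟨?_, ?_, ?_, ?_, ?_⟩ <;> grind

/-- The case of a vertex off both triangles adjacent to `u₁, u₂, u₃, t₁, t₂`. -/
theorem not_isRamseyFor_three_of_adj_triangle (hc : ∀ x y, c x y = c y x)
    (hF : EdgesMeetTriangles G c) (hK : NoSixClique G)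
    (h : OppositeTriangles G c t₁ t₂ t₃ u₁ u₂ u₃) {w : V}
    (hw : Outside t₁ t₂ t₃ u₁ u₂ u₃ w) (hu₁ : G.Adj w u₁) (hu₂ : G.Adj w u₂)
    (hu₃ : G.Adj w u₃) (ht₁ : G.Adj w t₁) (ht₂ : G.Adj w t₂) : ¬ IsRamseyFor G 3 := by
  have d := h.disjoint
  have hout : ∀ x, Outside t₁ t₂ t₃ u₁ u₂ u₃ x → x ≠ w →
      ¬ G.Adj u₁ x ∧ ¬ G.Adj u₂ x ∧ ¬ G.Adj u₃ x := by
    intro x hx hxw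
    have k₁ := h.swap.rotate hc |>.swap.color_of_adj hF (w := w) (x := x)
      (by grind [Outside]) hu₂ hu₃ hxw
    have k₂ := (h.swap.rotate hc).rotate hc |>.swap.color_of_adj hF (w := w) (x := x)
      (by grind [Outside]) hu₃ hu₁ hxw
    have k₃ := h.color_of_adj hF hw hu₁ hu₂ hxw
    grind [Outside]
  have ht₃ : ¬ G.Adj u₁ t₃ ∧ ¬ G.Adj u₂ t₃ ∧ ¬ G.Adj u₃ t₃ := by
    have hw' : Outside u₁ u₂ u₃ t₁ t₂ t₃ w := by grind [Outside]
    have k₁ := h.swap.rotate hc |>.swap.color_of_adj hF (w := w) (x := t₃)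
      (by grind [Outside]) hu₂ hu₃
    have k₂ := (h.swap.rotate hc).rotate hc |>.swap.color_of_adj hF (w := w) (x := t₃)
      (by grind [Outside]) hu₃ hu₁
    have k₃ := h.color_of_adj hF (x := t₃) hw hu₁ hu₂
    have l : ∀ x, x ≠ w → x ≠ t₁ → x ≠ t₂ → G.Adj x t₃ → c x t₃ = c u₁ u₂ := by
      intro x h₁ h₂ h₃ h₄
      rw [hc]
      exact (h.swap.color_of_adj hF hw' ht₁ ht₂ h₁ h₂ h₃ h₄.symm).1
    have l₁ := l u₁
    have l₂ := l u₂
    have l₃ := l u₃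
    have := h.ne_color
    have := h.rotate hc |>.ne_color
    grind [Outside]
  obtain ⟨u, hu, t, ht, hn⟩ : ∃ u, (u = u₁ ∨ u = u₂ ∨ u = u₃) ∧ ∃ t, (t = t₁ ∨ t = t₂) ∧
      ¬ G.Adj u t := by
    by_contra hno
    push Not at hno
    refine hK u₁ u₂ u₃ w t₁ t₂ ⟨h.u₁₂, h.u₁₃, hu₁.symm, ?_, ?_⟩ ⟨h.u₂₃, hu₂.symm, ?_, ?_⟩
      ⟨hu₃.symm, ?_, ?_⟩ ⟨ht₁, ht₂⟩ h.t₁₂ <;> exact hno _ (by simp) _ (by simp)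
  have key : ∀ t₁ t₂ u₁ u₂ u₃, OppositeTriangles G c t₁ t₂ t₃ u₁ u₂ u₃ →
      (∀ x, Outside t₁ t₂ t₃ u₁ u₂ u₃ x → x ≠ w → ¬ G.Adj u₃ x) → ¬ G.Adj u₂ t₃ →
      ¬ G.Adj u₁ t₁ → ¬ IsRamseyFor G 3 :=
    fun _ _ _ _ _ h => h.not_isRamseyFor_three_of_two_not_adj hF
  have h' := h.swap.rotate hc |>.swap
  have h'' := h'.swap.rotate hc |>.swap
  rcases ht with rfl | rfl <;> rcases hu with rfl | rfl | rfl
  · exact key _ _ _ _ _ h (by grind [Outside]) ht₃.2.1 hn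
  · exact key _ _ _ _ _ h' (by grind [Outside]) ht₃.2.2 hn
  · exact key _ _ _ _ _ h'' (by grind [Outside]) ht₃.1 hn
  · exact key _ _ _ _ _ (h.swap_first hc) (by grind [Outside]) ht₃.2.1 hn
  · exact key _ _ _ _ _ (h'.swap_first hc) (by grind [Outside]) ht₃.2.2 hn
  · exact key _ _ _ _ _ (h''.swap_first hc) (by grind [Outside]) ht₃.1 hn

/-- Two opposite triangles that are not completely joined to each other. -/
theorem not_isRamseyFor_three_of_not_adj (hc : ∀ x y, c x y = c y x)
    (hF : EdgesMeetTriangles G c) (hK : NoSixClique G)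
    (h : OppositeTriangles G c t₁ t₂ t₃ u₁ u₂ u₃) (hn : ¬ G.Adj t₃ u₃) :
    ¬ IsRamseyFor G 3 := by
  by_cases hw : ∃ w, Outside t₁ t₂ t₃ u₁ u₂ u₃ w ∧ G.Adj w t₁ ∧ G.Adj w t₂ ∧ G.Adj w u₁ ∧
      G.Adj w u₂
  · obtain ⟨w, hw, ht₁, ht₂, hu₁, hu₂⟩ := hw
    have hw' : Outside u₁ u₂ u₃ t₁ t₂ t₃ w := by grind [Outside]
    by_cases hu₃ : G.Adj w u₃
    · exact h.not_isRamseyFor_three_of_adj_triangle hc hF hK hw hu₁ hu₂ hu₃ ht₁ ht₂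
    by_cases ht₃ : G.Adj w t₃
    · exact h.swap.not_isRamseyFor_three_of_adj_triangle hc hF hK hw' ht₁ ht₂ ht₃ hu₁ hu₂
    have k : ∀ x, Outside t₁ t₂ t₃ u₁ u₂ u₃ x → ¬ G.Adj t₃ x ∧ ¬ G.Adj u₃ x := by
      intro x hx
      have k₁ := h.color_of_adj hF (x := x) hw hu₁ hu₂
      have k₂ := h.swap.color_of_adj hF (x := x) hw' ht₁ ht₂
      have := G.adj_comm w u₃
      have := G.adj_comm w t₃
      grind [Outside]
    refine not_isRamseyFor_three_of_independent_cover (G := G) (P₀ := fun x => x = t₁)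
      (P₁ := fun x => x = t₂) (P₂ := fun x => x = u₁) (P₃ := fun x => x = u₂)
      (P₄ := fun x => x = t₃ ∨ x = u₃ ∨ Outside t₁ t₂ t₃ u₁ u₂ u₃ x) ?_ ?_
    · grind [Outside]
    intro x y hxy
    have h₁ := hxy.symm
    have h₂ := hxy.ne
    have := h.not_adj_outside hF (x := x) (y := y)
    have := k x
    have := k y
    clear k hF hK hc
    refine ⟨?_, ?_, ?_, ?_, ?_⟩ <;> grind
  · push Not at hw
    refine not_isRamseyFor_three_of_independent_cover (G := G) (P₀ := fun x => x = t₃ ∨ x = u₃)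
      (P₁ := fun x => x = t₁ ∨ Outside t₁ t₂ t₃ u₁ u₂ u₃ x ∧ ¬ G.Adj x t₁)
      (P₂ := fun x => x = t₂ ∨ Outside t₁ t₂ t₃ u₁ u₂ u₃ x ∧ ¬ G.Adj x t₂)
      (P₃ := fun x => x = u₁ ∨ Outside t₁ t₂ t₃ u₁ u₂ u₃ x ∧ ¬ G.Adj x u₁)
      (P₄ := fun x => x = u₂ ∨ Outside t₁ t₂ t₃ u₁ u₂ u₃ x ∧ ¬ G.Adj x u₂) ?_ ?_
    · intro x
      have := hw x
      by_cases hx : Outside t₁ t₂ t₃ u₁ u₂ u₃ x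
      · grind
      · grind [Outside]
    intro x y hxy
    have h₁ := hxy.symm
    have h₂ := hxy.ne
    have := h.not_adj_outside hF (x := x) (y := y)
    clear hw hK hF hc
    refine ⟨?_, ?_, ?_, ?_, ?_⟩ <;> grind

theorem not_isRamseyFor_three (hc : ∀ x y, c x y = c y x)
    (hF : EdgesMeetTriangles G c) (hK : NoSixClique G)
    (h : OppositeTriangles G c t₁ t₂ t₃ u₁ u₂ u₃) : ¬ IsRamseyFor G 3 := by
  obtain ⟨u, hu, t, ht, hn⟩ : ∃ u, (u = u₁ ∨ u = u₂ ∨ u = u₃) ∧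
      ∃ t, (t = t₁ ∨ t = t₂ ∨ t = t₃) ∧ ¬ G.Adj t u := by
    by_contra hno
    push Not at hno
    refine hK t₁ t₂ t₃ u₁ u₂ u₃ ⟨h.t₁₂, h.t₁₃, ?_, ?_, ?_⟩ ⟨h.t₂₃, ?_, ?_, ?_⟩
      ⟨?_, ?_, ?_⟩ ⟨h.u₁₂, h.u₁₃⟩ h.u₂₃ <;> exact hno _ (by simp) _ (by simp)
  have key : ∀ t₁ t₂ t₃, OppositeTriangles G c t₁ t₂ t₃ u₁ u₂ u₃ → ¬ G.Adj t₃ u →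
      ¬ IsRamseyFor G 3 := by
    intro t₁ t₂ t₃ h hn
    have h' := h.swap.rotate hc |>.swap
    have h'' := h'.swap.rotate hc |>.swap
    rcases hu with rfl | rfl | rfl
    · exact h'.not_isRamseyFor_three_of_not_adj hc hF hK hn
    · exact h''.not_isRamseyFor_three_of_not_adj hc hF hK hn
    · exact h.not_isRamseyFor_three_of_not_adj hc hF hK hn
  rcases ht with rfl | rfl | rfl
  · exact key _ _ _ (h.rotate hc) hn
  · exact key _ _ _ ((h.rotate hc).rotate hc) hn
  · exact key _ _ _ h hn

end OppositeTriangles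

theorem K6_subgraph_of_ramsey_K3_not_ramsey_K3_add_K2
    {V : Type*} [Fintype V] (G : SimpleGraph V)
    (h3 : IsRamseyFor G 3) (hnot : ¬ IsRamseyForPair G 3 2) :
    ∃ S : Finset V, S.card = 6 ∧ ∀ x ∈ S, ∀ y ∈ S, x ≠ y → G.Adj x y := by
  classical
  by_contra hno
  have hK : NoSixClique G := by
    rintro x₁ x₂ x₃ x₄ x₅ x₆ ⟨a₁₂, a₁₃, a₁₄, a₁₅, a₁₆⟩ ⟨a₂₃, a₂₄, a₂₅, a₂₆⟩ ⟨a₃₄, a₃₅, a₃₆⟩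
      ⟨a₄₅, a₄₆⟩ a₅₆
    refine hno ⟨{x₁, x₂, x₃, x₄, x₅, x₆}, ?_, ?_⟩
    · simp [Finset.card_insert_of_notMem, a₁₂.ne, a₁₃.ne, a₁₄.ne, a₁₅.ne, a₁₆.ne, a₂₃.ne,
        a₂₄.ne, a₂₅.ne, a₂₆.ne, a₃₄.ne, a₃₅.ne, a₃₆.ne, a₄₅.ne, a₄₆.ne, a₅₆.ne]
    · have := G.adj_comm
      intro x hx y hy hxy
      simp only [Finset.mem_insert, Finset.mem_singleton] at hx hy
      rcases hx with rfl | rfl | rfl | rfl | rfl | rfl <;>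
      rcases hy with rfl | rfl | rfl | rfl | rfl | rfl <;>
      first | exact absurd rfl hxy | assumption | (apply SimpleGraph.Adj.symm; assumption)
  unfold IsRamseyForPair at hnot
  push Not at hnot
  obtain ⟨c, hc, hnone⟩ := hnot
  have hF : EdgesMeetTriangles G c := by
    refine edgesMeetTriangles_of_forall_not hc ?_
    rintro ⟨b, S, T, hd, hS, hT⟩
    exact hnone b S T hd hS hT
  obtain ⟨r, S, hS, hadj, hmono⟩ := h3 c hc
  obtain ⟨a, b, d, hab, had, hbd, rfl⟩ := Finset.card_eq_three.1 hS
  have aab := hadj a (by simp) b (by simp) hab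
  have aad := hadj a (by simp) d (by simp) had
  have abd := hadj b (by simp) d (by simp) hbd
  have cab := hmono a (by simp) b (by simp) hab
  have cad := hmono a (by simp) d (by simp) had
  have cbd := hmono b (by simp) d (by simp) hbd
  refine not_isRamseyFor_three_of_triangleFree_outside hF aab aad abd
    (cab.trans cad.symm) (cab.trans cbd.symm) ?_ h3
  intro x y z hxa hxb hxd hya hyb hyd hza hzb hzd hxy hxz hyz
  have hne : ∀ p q, p ≠ a → p ≠ b → p ≠ d → q ≠ a → q ≠ b → q ≠ d → G.Adj p q →
      c p q = !r := by
    intro p q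
    have := hF a b d p q aab aad abd
    have : c p q = r ∨ c p q = !r := by cases c p q <;> cases r <;> simp
    grind
  have cxy := hne x y hxa hxb hxd hya hyb hyd hxy
  have cxz := hne x z hxa hxb hxd hza hzb hzd hxz
  have cyz := hne y z hya hyb hyd hza hzb hzd hyz
  have h : OppositeTriangles G c a b d x y z := by
    constructor <;> grind
  exact h.not_isRamseyFor_three hc hF hK h3
end

section
/- (Ramsey stability) Let n ≥ 4 and let G be a finite simple graph that is Ramsey for K_n. Let V be a set of vertices of G with 2n ≤ |V| ≤ 3n − 3, let V_0 ⊆ V be any set with |V_0| ≤ 2n − 2, and let x and y be two distinct vertices of V ∖ V_0. Then, in every 2-colouring of the edges of G, there exists a monochromatic K_{n-1} on a vertex set W with W disjoint from V_0, such that either W ∩ V = {x}, or W ∩ V = {y}, or W ∩ V contains neither x nor y. -/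
open Finset

/-- A monochromatic clique restricts to its subsets. -/
theorem IsMonoClique.mono {V : Type*} {G : SimpleGraph V} {c : V → V → Bool} {b : Bool}
    {m : ℕ} {S T : Finset V} (hS : IsMonoClique G c b m S) (hT : T ⊆ S) :
    IsMonoClique G c b T.card T :=
  ⟨rfl, fun u hu v hv => hS.2.1 u (hT hu) v (hT hv),
    fun u hu v hv => hS.2.2 u (hT hu) v (hT hv)⟩

/-- The roles of vertices in the recolouring: `out` is outside `V`, the vertices `x` and `y` are
the two special ones, `rest` is the remainder of `V`, and two blocks of `n - 1` vertices each have
one vertex `a₀` (resp. `b₀`) treated differently, and a marker `p` (resp. `q`) among the others. -/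
inductive Role
  | out | rest | x | y | a | p | a₀ | b | q | b₀
  deriving DecidableEq

namespace Role

/-- The prescribed colours between roles, in one of the two orders. -/
def halfColour : Role → Role → Option Bool
  | a, a | a, p | a, a₀ | p, p | p, a₀ | a₀, a₀ => some false
  | b, b | b, q | b, b₀ | q, q | q, b₀ | b₀, b₀ => some true
  | a, out | p, out | a₀, out => some true
  | b, out | q, out | b₀, out => some false
  | a, x | p, x => some false
  | a, y | a, rest | p, y | p, rest => some true
  | a₀, y | a₀, rest => some false
  | a₀, x => some true
  | b, y | q, y => some true
  | b, x | b, rest | q, x | q, rest => some false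
  | b₀, x | b₀, rest => some true
  | b₀, y => some false
  | x, rest => some true
  | y, rest => some false
  | p, q => some false
  | p, b | p, b₀ => some true
  | a, q | a₀, q => some true
  | a, b | a, b₀ | a₀, b | a₀, b₀ => some false
  | _, _ => none

/-- The prescribed colour between two roles; `none` means that the old colour is kept. -/
def colour (k l : Role) : Option Bool := (halfColour k l).or (halfColour l k)

theorem colour_comm (k l : Role) : colour k l = colour l k := by
  cases k <;> cases l <;> rfl

end Role

/-- Recolour the edges according to the roles of their ends. -/
def recolour {V : Type*} (f : V → Role) (c : V → V → Bool) (u v : V) : Bool :=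
  (Role.colour (f u) (f v)).getD (c u v)

theorem recolour_comm {V : Type*} (f : V → Role) {c : V → V → Bool}
    (hc : ∀ u v, c u v = c v u) (u v : V) : recolour f c u v = recolour f c v u := by
  rw [recolour, recolour, Role.colour_comm, hc]

/-- The size bound for a clique `S` in one colour of the recolouring, in terms of which vertices
of the various blocks can occur together in `S`. -/
theorem card_lt_of_block_exclusions {α : Type*} [DecidableEq α] {n : ℕ} (hn : 4 ≤ n)
    {O Z A B S : Finset α} {a b x y : α}
    (hZ : Z.card ≤ n - 3) (hB : B.card ≤ n - 2)
    (hcov : ∀ u ∈ S, u ∈ O ∨ u ∈ Z ∨ u = x ∨ u = y ∨ u ∈ insert a A ∨ u ∈ insert b B)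
    (hA : ∀ u ∈ S, ∀ v ∈ S, u ∈ insert a A → v ∈ insert a A → u = v)
    (hBO : ∀ u ∈ S, ∀ v ∈ S, u ∈ insert b B → v ∉ O)
    (hAx : ∀ u ∈ S, u ∈ A → x ∉ S)
    (haZ : a ∈ S → ∀ v ∈ S, v ∉ Z) (hay : a ∈ S → y ∉ S)
    (hyZ : y ∈ S → ∀ v ∈ S, v ∉ Z)
    (hBx : ∀ u ∈ S, u ∈ B → x ∉ S) (hBZ : ∀ u ∈ S, u ∈ B → ∀ v ∈ S, v ∉ Z)
    (hby : b ∈ S → y ∉ S)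
    (hAB : ∀ u ∈ S, u ∈ insert a A → ∃ v ∈ B, v ∉ S)
    (hOZ : ∀ T ⊆ S, T ⊆ O ∪ Z → T.card ≤ n - 2)
    (hOx : ∀ T ⊆ S, T ⊆ insert x O → T.card ≤ n - 2)
    (hOy : ∀ T ⊆ S, T ⊆ insert y O → T.card ≤ n - 2) :
    S.card < n := by
  have erase_bound (w : α) (h : (S.erase w).card ≤ n - 2) : S.card < n := by
    have := S.pred_card_le_card_erase (a := w)
    omega
  have two (u v : α) : ({u, v} : Finset α).card ≤ 2 := card_le_two
  by_cases hb : ∃ u ∈ S, u ∈ insert b B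
  · obtain ⟨u, huS, hu⟩ := hb
    have hO : ∀ v ∈ S, v ∉ O := fun v hv => hBO u huS v hv hu
    by_cases hB1 : ∃ u ∈ S, u ∈ B
    · obtain ⟨w, hwS, hw⟩ := hB1
      have hx := hBx w hwS hw
      have hz := hBZ w hwS hw
      -- at most one of `b` and `y` occurs
      obtain ⟨t, ht⟩ : ∃ t, ∀ v ∈ S, v = b ∨ v = y → v = t := by
        by_cases h : b ∈ S
        · exact ⟨b, by grind⟩
        · exact ⟨y, by grind⟩
      by_cases ha : ∃ v ∈ S, v ∈ insert a A
      · obtain ⟨v, hvS, hv⟩ := ha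
        obtain ⟨r, hrB, hrS⟩ := hAB v hvS hv
        have hsub : S ⊆ {v, t} ∪ B.erase r := by
          intro s hs
          have := hcov s hs
          grind
        have h1 := (card_le_card hsub).trans (card_union_le _ _)
        have h2 := card_erase_of_mem hrB
        have := two v t
        omega
      · have hsub : S ⊆ insert t B := by
          intro s hs
          have := hcov s hs
          grind
        have h1 := (card_le_card hsub).trans (card_insert_le _ _)
        omega
    · have hbS : b ∈ S := by grind
      have hy := hby hbS
      by_cases ha : a ∈ S
      · have hsub : S ⊆ {a, b, x} := by
          intro s hs
          have := hcov s hs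
          grind
        have h1 := (card_le_card hsub).trans card_le_three
        omega
      · obtain ⟨t, ht⟩ : ∃ t, ∀ v ∈ S, v = x ∨ v ∈ A → v = t := by
          by_cases h : ∃ v ∈ S, v ∈ A
          · obtain ⟨v, hvS, hv⟩ := h
            exact ⟨v, by grind⟩
          · exact ⟨x, by grind⟩
        have hsub : S ⊆ {b, t} ∪ Z := by
          intro s hs
          have := hcov s hs
          grind
        have h1 := (card_le_card hsub).trans (card_union_le _ _)
        have := two b t
        omega
  · by_cases ha : a ∈ S
    · refine erase_bound a (hOx _ (erase_subset _ _) fun s hs => ?_)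
      have := hcov s (mem_of_mem_erase hs)
      grind
    · by_cases hA1 : ∃ v ∈ S, v ∈ A
      · obtain ⟨v, hvS, hv⟩ := hA1
        have hx := hAx v hvS hv
        by_cases hy : y ∈ S
        · refine erase_bound v (hOy _ (erase_subset _ _) fun s hs => ?_)
          have := hcov s (mem_of_mem_erase hs)
          grind
        · refine erase_bound v (hOZ _ (erase_subset _ _) fun s hs => ?_)
          have := hcov s (mem_of_mem_erase hs)
          grind
      · by_cases hy : y ∈ S
        · refine erase_bound x (hOy _ (erase_subset _ _) fun s hs => ?_)
          have := hcov s (mem_of_mem_erase hs)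
          grind
        · refine erase_bound x (hOZ _ (erase_subset _ _) fun s hs => ?_)
          have := hcov s (mem_of_mem_erase hs)
          grind

/-- Recolouring by roles destroys all monochromatic cliques on `n` vertices, provided that the
cliques in the part of the graph where the colours are kept are small. -/
theorem not_isMonoClique_recolour {α : Type*} [Fintype α] [DecidableEq α] {n : ℕ} (hn : 4 ≤ n)
    {G : SimpleGraph α} {c : α → α → Bool} {f : α → Role} {x y a b p q r s : α}
    (hx : ∀ u, f u = .x ↔ u = x) (hy : ∀ u, f u = .y ↔ u = y)
    (ha : ∀ u, f u = .a₀ ↔ u = a) (hb : ∀ u, f u = .b₀ ↔ u = b)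
    (hp : f p = .p) (hq : f q = .q) (hr : f r = .a) (hs : f s = .b)
    (hZ : (univ.filter fun u => f u = .rest).card ≤ n - 3)
    (hA : (univ.filter fun u => f u = .a ∨ f u = .p).card ≤ n - 2)
    (hB : (univ.filter fun u => f u = .b ∨ f u = .q).card ≤ n - 2)
    (hOZ : ∀ d T, IsMonoClique G c d T.card T → (∀ u ∈ T, f u = .out ∨ f u = .rest) →
      T.card ≤ n - 2)
    (hOx : ∀ d T, IsMonoClique G c d T.card T → (∀ u ∈ T, f u = .out ∨ f u = .x) →
      T.card ≤ n - 2)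
    (hOy : ∀ d T, IsMonoClique G c d T.card T → (∀ u ∈ T, f u = .out ∨ f u = .y) →
      T.card ≤ n - 2)
    (d : Bool) (S : Finset α) : ¬ IsMonoClique G (recolour f c) d n S := by
  intro hS
  have key : ∀ u ∈ S, ∀ v ∈ S, u ≠ v → Role.colour (f u) (f v) ≠ some !d := by
    intro u hu v hv huv h
    have := hS.2.2 u hu v hv huv
    simp [recolour, h] at this
  have keep : ∀ T ⊆ S, (∀ u ∈ T, ∀ v ∈ T, u ≠ v → Role.colour (f u) (f v) = none) →
      IsMonoClique G c d T.card T := by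
    intro T hT h
    refine ⟨rfl, (hS.mono hT).2.1, fun u hu v hv huv => ?_⟩
    have := (hS.mono hT).2.2 u hu v hv huv
    simpa [recolour, h u hu v hv huv] using this
  have hOZ' : ∀ T ⊆ S, (∀ u ∈ T, f u = .out ∨ f u = .rest) → T.card ≤ n - 2 := by
    intro T hT h
    refine hOZ d T (keep T hT fun u hu v hv _ => ?_) h
    rcases h u hu with h1 | h1 <;> rcases h v hv with h2 | h2 <;> rw [h1, h2] <;> rfl
  have hOx' : ∀ T ⊆ S, (∀ u ∈ T, f u = .out ∨ f u = .x) → T.card ≤ n - 2 := by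
    intro T hT h
    refine hOx d T (keep T hT fun u hu v hv _ => ?_) h
    rcases h u hu with h1 | h1 <;> rcases h v hv with h2 | h2 <;> rw [h1, h2] <;> rfl
  have hOy' : ∀ T ⊆ S, (∀ u ∈ T, f u = .out ∨ f u = .y) → T.card ≤ n - 2 := by
    intro T hT h
    refine hOy d T (keep T hT fun u hu v hv _ => ?_) h
    rcases h u hu with h1 | h1 <;> rcases h v hv with h2 | h2 <;> rw [h1, h2] <;> rfl
  have hfx := (hx x).2 rfl
  have hfy := (hy y).2 rfl
  have hfa := (ha a).2 rfl
  have hfb := (hb b).2 rfl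
  have clash {u v : α} {k l : Role} (hu : u ∈ S) (hv : v ∈ S) (hk : f u = k) (hl : f v = l)
      (h : k ≠ l ∧ Role.colour k l = some !d) : False := by
    subst hk hl
    exact key u hu v hv (fun huv => h.1 (huv ▸ rfl)) h.2
  refine absurd hS.1 (ne_of_lt ?_)
  cases d with
  | true =>
    refine card_lt_of_block_exclusions hn (x := x) (y := y) (a := a) (b := b)
      (O := univ.filter fun u => f u = .out) hZ hB
      (A := univ.filter fun u => f u = .a ∨ f u = .p) ?_ ?_ ?_ ?_ ?_ ?_ ?_ ?_ ?_ ?_ ?_ ?_ ?_ ?_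
    all_goals try simp only [mem_insert, mem_filter, mem_univ, true_and, ← hx, ← hy, ← ha, ← hb]
    · intro u _
      cases f u <;> simp
    · intro u hu v hv h1 h2
      by_contra huv
      refine key u hu v hv huv ?_
      rcases h1 with h1 | h1 | h1 <;> rcases h2 with h2 | h2 | h2 <;> rw [h1, h2] <;> rfl
    · intro u hu v hv h1 h2
      rcases h1 with h1 | h1 | h1 <;> exact clash hu hv h1 h2 (by decide)
    · intro u hu h1 h2
      rcases h1 with h1 | h1 <;> exact clash hu h2 h1 hfx (by decide)
    · exact fun h1 v hv h2 => clash h1 hv hfa h2 (by decide)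
    · exact fun h1 h2 => clash h1 h2 hfa hfy (by decide)
    · exact fun h1 v hv h2 => clash h1 hv hfy h2 (by decide)
    · intro u hu h1 h2
      rcases h1 with h1 | h1 <;> exact clash hu h2 h1 hfx (by decide)
    · intro u hu h1 v hv h2
      rcases h1 with h1 | h1 <;> exact clash hu hv h1 h2 (by decide)
    · exact fun h1 h2 => clash h1 h2 hfb hfy (by decide)
    · rintro u hu (h1 | h1 | h1)
      · exact ⟨s, .inl hs, fun h2 => clash hu h2 h1 hs (by decide)⟩
      · exact ⟨s, .inl hs, fun h2 => clash hu h2 h1 hs (by decide)⟩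
      · exact ⟨q, .inr hq, fun h2 => clash hu h2 h1 hq (by decide)⟩
    · exact fun T hT h => hOZ' T hT fun u hu => by simpa using h hu
    · exact fun T hT h => hOx' T hT fun u hu => by simpa [← hx, ← hy, or_comm] using h hu
    · exact fun T hT h => hOy' T hT fun u hu => by simpa [← hx, ← hy, or_comm] using h hu
  | false =>
    refine card_lt_of_block_exclusions hn (x := y) (y := x) (a := b) (b := a)
      (O := univ.filter fun u => f u = .out) hZ hA
      (A := univ.filter fun u => f u = .b ∨ f u = .q) ?_ ?_ ?_ ?_ ?_ ?_ ?_ ?_ ?_ ?_ ?_ ?_ ?_ ?_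
    all_goals try simp only [mem_insert, mem_filter, mem_univ, true_and, ← hx, ← hy, ← ha, ← hb]
    · intro u _
      cases f u <;> simp
    · intro u hu v hv h1 h2
      by_contra huv
      refine key u hu v hv huv ?_
      rcases h1 with h1 | h1 | h1 <;> rcases h2 with h2 | h2 | h2 <;> rw [h1, h2] <;> rfl
    · intro u hu v hv h1 h2
      rcases h1 with h1 | h1 | h1 <;> exact clash hu hv h1 h2 (by decide)
    · intro u hu h1 h2
      rcases h1 with h1 | h1 <;> exact clash hu h2 h1 hfy (by decide)
    · exact fun h1 v hv h2 => clash h1 hv hfb h2 (by decide)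
    · exact fun h1 h2 => clash h1 h2 hfb hfx (by decide)
    · exact fun h1 v hv h2 => clash h1 hv hfx h2 (by decide)
    · intro u hu h1 h2
      rcases h1 with h1 | h1 <;> exact clash hu h2 h1 hfy (by decide)
    · intro u hu h1 v hv h2
      rcases h1 with h1 | h1 <;> exact clash hu hv h1 h2 (by decide)
    · exact fun h1 h2 => clash h1 h2 hfa hfx (by decide)
    · rintro u hu (h1 | h1 | h1)
      · exact ⟨p, .inr hp, fun h2 => clash hu h2 h1 hp (by decide)⟩
      · exact ⟨p, .inr hp, fun h2 => clash hu h2 h1 hp (by decide)⟩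
      · exact ⟨r, .inl hr, fun h2 => clash hu h2 h1 hr (by decide)⟩
    · exact fun T hT h => hOZ' T hT fun u hu => by simpa using h hu
    · exact fun T hT h => hOy' T hT fun u hu => by simpa [← hx, ← hy, or_comm] using h hu
    · exact fun T hT h => hOx' T hT fun u hu => by simpa [← hx, ← hy, or_comm] using h hu

theorem ramsey_stability (n : ℕ) (hn : 4 ≤ n)
    {α : Type*} [Fintype α] [DecidableEq α] (G : SimpleGraph α)
    (hG : IsRamseyFor G n)
    (V : Finset α) (hVlb : 2 * n ≤ V.card) (hVub : V.card ≤ 3 * n - 3)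
    (V₀ : Finset α) (hV₀ : V₀ ⊆ V) (hV₀card : V₀.card ≤ 2 * n - 2)
    (x y : α) (hx : x ∈ V \ V₀) (hy : y ∈ V \ V₀) (hxy : x ≠ y)
    (c : α → α → Bool) (hc : ∀ u v, c u v = c v u) :
    ∃ b W, IsMonoClique G c b (n - 1) W ∧ Disjoint W V₀ ∧
      (W ∩ V = {x} ∨ W ∩ V = {y} ∨ (x ∉ W ∩ V ∧ y ∉ W ∩ V)) := by
  by_contra hno
  -- enlarge `V₀` to `2 n - 2` vertices and split it into two blocks
  simp only [mem_sdiff] at hx hy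
  obtain ⟨U, hVU, hUV, hU⟩ : ∃ U, V₀ ⊆ U ∧ U ⊆ (V.erase x).erase y ∧ U.card = 2 * n - 2 := by
    refine exists_subsuperset_card_eq ?_ hV₀card ?_
    · grind
    · rw [card_erase_of_mem (by grind), card_erase_of_mem hx.1]
      omega
  obtain ⟨A, hAU, hA⟩ := exists_subset_card_eq (s := U) (n := n - 1) (by omega)
  have hB : (U \ A).card = n - 1 := by
    rw [card_sdiff_of_subset hAU]
    omega
  -- distinguished vertices in a block
  have pick (T : Finset α) (hT : T.card = n - 1) :
      ∃ a ∈ T, ∃ p ∈ T, ∃ r ∈ T, a ≠ p ∧ a ≠ r ∧ p ≠ r := by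
    obtain ⟨a, p, r, h⟩ := two_lt_card_iff.1 (show 2 < T.card by omega)
    exact ⟨a, h.1, p, h.2.1, r, h.2.2.1, h.2.2.2⟩
  obtain ⟨a, ha, p, hp, r, hr, hap, har, hpr⟩ := pick A hA
  obtain ⟨b, hb, q, hq, s, hs, hbq, hbs, hqs⟩ := pick (U \ A) hB
  clear pick
  let f : α → Role := fun u =>
    if u = x then .x else if u = y then .y else if u ∉ V then .out else if u ∉ U then .rest else
    if u ∈ A then (if u = a then .a₀ else if u = p then .p else .a) else
    if u = b then .b₀ else if u = q then .q else .b
  have hxU : x ∉ U := fun h => by have := hUV h; grind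
  have hyU : y ∉ U := fun h => by have := hUV h; grind
  -- a clique avoiding `U` whose trace on `V` is of one of the three kinds is small
  have small (d : Bool) (T : Finset α) (hT : IsMonoClique G c d T.card T) (hTU : ∀ u ∈ T, u ∉ U)
      (h : (∀ u ∈ T, u ∉ V ∨ u = x) ∨ (∀ u ∈ T, u ∉ V ∨ u = y) ∨ (x ∉ T ∧ y ∉ T)) :
      T.card ≤ n - 2 := by
    by_contra! hcard
    obtain ⟨W, hWT, hW⟩ := exists_subset_card_eq (s := T) (n := n - 1) (by omega)
    refine hno ⟨d, W, hW ▸ hT.mono hWT, ?_, ?_⟩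
    · exact disjoint_left.2 fun u hu hu' => hTU u (hWT hu) (hVU hu')
    · by_cases hxy' : x ∉ W ∧ y ∉ W
      · grind
      · rcases h with h | h | h
        · left
          ext u
          have := h y
          have := h u
          grind
        · right
          left
          ext u
          have := h x
          have := h u
          grind
        · grind
  obtain ⟨d, S, hS⟩ := hG (recolour f c) (recolour_comm f hc)
  refine not_isMonoClique_recolour hn (f := f) (x := x) (y := y) (a := a) (b := b) (p := p)
    (q := q) (r := r) (s := s) ?_ ?_ ?_ ?_ ?_ ?_ ?_ ?_ ?_ ?_ ?_ ?_ ?_ ?_ d S hS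
  · grind
  · grind
  · grind
  · grind
  · grind
  · grind
  · grind
  · grind
  · have hsub : (univ.filter fun u => f u = .rest) ⊆ ((V.erase x).erase y) \ U := by
      intro u hu
      replace hu := (mem_filter.1 hu).2
      clear small hno
      grind
    refine (card_le_card hsub).trans ?_
    rw [card_sdiff_of_subset hUV, card_erase_of_mem (by grind), card_erase_of_mem hx.1]
    omega
  · have hsub : (univ.filter fun u => f u = .a ∨ f u = .p) ⊆ A.erase a := by
      intro u hu
      replace hu := (mem_filter.1 hu).2
      clear small hno
      grind
    refine (card_le_card hsub).trans ?_
    rw [card_erase_of_mem ha]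
    omega
  · have hsub : (univ.filter fun u => f u = .b ∨ f u = .q) ⊆ (U \ A).erase b := by
      intro u hu
      replace hu := (mem_filter.1 hu).2
      clear small hno
      grind
    refine (card_le_card hsub).trans ?_
    rw [card_erase_of_mem hb]
    omega
  · exact fun d T hT h => small d T hT (by grind) (by grind)
  · exact fun d T hT h => small d T hT (by grind) (by grind)
  · exact fun d T hT h => small d T hT (by grind) (by grind)
end

section
/- Let n ≥ 3 and let G be a finite simple graph that is Ramsey for K_n. If V is a set of vertices of G with |V| ≤ 2n − 2, then the induced subgraph of G on the complement of V is Ramsey for K_{n-1}. -/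
open Finset

/-- A monochromatic clique with at least `m` vertices inside `s` restricts to a monochromatic
`K_m` of the subgraph induced on `s`. -/
theorem IsMonoClique.exists_induce {V : Type*} {G : SimpleGraph V} {d : V → V → Bool} {b : Bool}
    {l : ℕ} {S : Finset V} (hS : IsMonoClique G d b l S) (s : Set V) [DecidablePred (· ∈ s)]
    {m : ℕ} (hm : m ≤ (S.filter (· ∈ s)).card) {c : s → s → Bool}
    (hc : ∀ x y : s, d x y = c x y) :
    ∃ T, IsMonoClique (G.induce s) c b m T := by
  obtain ⟨T, hT, hTm⟩ := exists_subset_card_eq (s := S.subtype (· ∈ s)) (n := m)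
    (by rwa [Finset.card_subtype])
  have hmem : ∀ x ∈ T, (x : V) ∈ S := fun x hx => Finset.mem_subtype.1 (hT hx)
  refine ⟨T, hTm, fun x hx y hy hxy => ?_, fun x hx y hy hxy => ?_⟩
  · exact hS.2.1 x (hmem x hx) y (hmem y hy) (Subtype.coe_injective.ne hxy)
  · rw [← hc]
    exact hS.2.2 x (hmem x hx) y (hmem y hy) (Subtype.coe_injective.ne hxy)

/-- The extension of a colouring `c` of the edges inside `s` to all edges, where every vertex `x`
outside `s` lies on a side `(p x).1` at a position `(p x).2`: edges from a vertex to `s` get the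
colour of its side, edges within a side get the opposite colour, and edges between the two sides
are `true` exactly when the positions agree. -/
def extendColouring {V ι : Type*} [DecidableEq ι] (s : Set V) [DecidablePred (· ∈ s)]
    (p : (sᶜ : Set V) → Bool × ι) (c : s → s → Bool) (x y : V) : Bool :=
  if hx : x ∈ s then
    if hy : y ∈ s then c ⟨x, hx⟩ ⟨y, hy⟩ else (p ⟨y, hy⟩).1
  else
    if hy : y ∈ s then (p ⟨x, hx⟩).1
    else if (p ⟨x, hx⟩).1 = (p ⟨y, hy⟩).1 then !(p ⟨x, hx⟩).1
    else decide ((p ⟨x, hx⟩).2 = (p ⟨y, hy⟩).2)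

theorem extendColouring_comm {V ι : Type*} [DecidableEq ι] (s : Set V) [DecidablePred (· ∈ s)]
    (p : (sᶜ : Set V) → Bool × ι) {c : s → s → Bool} (hc : ∀ x y, c x y = c y x) (x y : V) :
    extendColouring s p c x y = extendColouring s p c y x := by
  unfold extendColouring
  split_ifs <;> grind

/-- A monochromatic clique of the extended colouring with more vertices than there are positions
has at most one vertex outside `s`. -/
theorem IsMonoClique.card_filter_notMem_le_one {V ι : Type*} [Fintype ι]
    [DecidableEq ι] [Nontrivial ι] {G : SimpleGraph V} {s : Set V} [DecidablePred (· ∈ s)]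
    {p : (sᶜ : Set V) → Bool × ι} (hp : Function.Injective p) {c : s → s → Bool} {b : Bool}
    {l : ℕ} {S : Finset V} (hS : IsMonoClique G (extendColouring s p c) b l S)
    (hl : Fintype.card ι < l) : (S.filter (· ∉ s)).card ≤ 1 := by
  obtain ⟨hcard, -, hcol⟩ := hS
  have same_side : ∀ x y : (sᶜ : Set V), (x : V) ∈ S → (y : V) ∈ S → (p x).1 = b →
      (p y).1 = b → x = y := by
    intro x y hxS hyS hx hy
    by_contra hxy
    have h := hcol x hxS y hyS (Subtype.coe_injective.ne hxy)
    have hxs : (x : V) ∉ s := x.2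
    have hys : (y : V) ∉ s := y.2
    simp [extendColouring, hxs, hys, hx, hy] at h
  by_cases hw : ∃ w ∈ S, w ∈ s
  · obtain ⟨w, hwS, hws⟩ := hw
    have side : ∀ x : (sᶜ : Set V), (x : V) ∈ S → (p x).1 = b := by
      intro x hxS
      have hxs : (x : V) ∉ s := x.2
      have h := hcol x hxS w hwS (fun e => hxs (e ▸ hws))
      simpa [extendColouring, hxs, hws] using h
    refine Finset.card_le_one.2 fun x hx y hy => ?_
    rw [Finset.mem_filter] at hx hy
    exact congrArg Subtype.val (same_side ⟨x, hx.2⟩ ⟨y, hy.2⟩ hx.1 hy.1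
      (side ⟨x, hx.2⟩ hx.1) (side ⟨y, hy.2⟩ hy.1))
  · push Not at hw
    exfalso
    let T : Finset (sᶜ : Set V) := S.subtype (· ∈ sᶜ)
    have hT : T.card = l := by
      rw [Finset.card_subtype, Finset.filter_true_of_mem (p := (· ∈ sᶜ)) hw, hcard]
    have mem_T : ∀ x, x ∈ T ↔ (x : V) ∈ S := fun x => Finset.mem_subtype
    have hone : (T.filter fun x => (p x).1 = b).card ≤ 1 := by
      refine Finset.card_le_one.2 fun x hx y hy => ?_
      rw [Finset.mem_filter, mem_T] at hx hy
      exact same_side x y hx.1 hy.1 hx.2 hy.2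
    have hsum := Finset.card_filter_add_card_filter_not (s := T) (fun x => (p x).1 = b)
    set U := T.filter fun x => ¬ (p x).1 = b with hU
    have hinj : Set.InjOn (fun x => (p x).2) U := by
      intro x hx y hy hxy
      have hx' := (Finset.mem_filter.1 hx).2
      have hy' := (Finset.mem_filter.1 hy).2
      exact hp (Prod.ext ((Bool.eq_not.2 hx').trans (Bool.eq_not.2 hy').symm) hxy)
    have himg : (U.image fun x => (p x).2).card = U.card := Finset.card_image_of_injOn hinj
    have hle := Finset.card_le_univ (U.image fun x => (p x).2)
    have huniv : (U.image fun x => (p x).2) = Finset.univ :=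
      (Finset.card_eq_iff_eq_univ _).1 (by omega)
    obtain ⟨z, hz⟩ : (T.filter fun x => (p x).1 = b).Nonempty :=
      Finset.card_pos.1 (by omega)
    rw [Finset.mem_filter, mem_T] at hz
    obtain ⟨j, hj⟩ : ∃ j, decide ((p z).2 = j) ≠ b := by
      cases b
      · exact ⟨(p z).2, by simp⟩
      · obtain ⟨j, hj⟩ := exists_ne (p z).2
        exact ⟨j, by simpa using hj.symm⟩
    obtain ⟨y, hyU, rfl⟩ := Finset.mem_image.1 (huniv ▸ Finset.mem_univ j)
    rw [hU, Finset.mem_filter, mem_T] at hyU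
    have hzy : (p z).1 ≠ (p y).1 := fun e => hyU.2 (e ▸ hz.2)
    have hne : (z : V) ≠ y := fun e => hzy (by rw [Subtype.ext e])
    have hzs : (z : V) ∉ s := z.2
    have hys : (y : V) ∉ s := y.2
    have h := hcol z hz.1 y hyU.1 hne
    simp only [extendColouring, hzs, hys, dite_false, if_neg hzy] at h
    exact hj h

theorem ramsey_of_remove_vertices (n : ℕ) (hn : 3 ≤ n)
    {α : Type*} [Fintype α] [DecidableEq α] (G : SimpleGraph α)
    (hG : IsRamseyFor G n)
    (V : Finset α) (hV : V.card ≤ 2 * n - 2) :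
    IsRamseyFor (G.induce (↑Vᶜ : Set α)) (n - 1) := by
  set s : Set α := ↑Vᶜ with hs
  intro c hc
  classical
  have : Nontrivial (Fin (n - 1)) := Fin.nontrivial_iff_two_le.2 (by omega)
  have hsV : Fintype.card (sᶜ : Set α) = V.card := by
    rw [← Set.toFinset_card]
    congr 1
    ext x
    simp [hs]
  obtain ⟨p⟩ : Nonempty ((sᶜ : Set α) ↪ Bool × Fin (n - 1)) :=
    Function.Embedding.nonempty_of_card_le (by
      rw [hsV, Fintype.card_prod, Fintype.card_bool, Fintype.card_fin]
      omega)
  obtain ⟨b, S, hS⟩ := hG (extendColouring s p c) (extendColouring_comm s p hc)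
  have hout := hS.card_filter_notMem_le_one p.injective (by rw [Fintype.card_fin]; omega)
  have hsum := Finset.card_filter_add_card_filter_not (s := S) (· ∈ s)
  have hcard := hS.1
  exact ⟨b, hS.exists_induce s (by omega) (by simp [extendColouring])⟩
end

section
/- Let G be a finite simple graph that is Ramsey for K_3, and suppose a 2-colouring of the edges of G contains no monochromatic copy of K_3 + K_2. Then this colouring contains both a monochromatic K_3 in colour red and a monochromatic K_3 in colour blue. -/
open Finset

/-- In a Ramsey graph for `K 3`, every symmetric colouring has a monochromatic triangle,
given by its three vertices. -/
lemma IsRamseyFor.exists_triangle {V : Type*} {G : SimpleGraph V} (hG : IsRamseyFor G 3)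
    (c : V → V → Bool) (hc : ∀ x y, c x y = c y x) :
    ∃ x y z, G.Adj x y ∧ G.Adj y z ∧ G.Adj x z ∧ c x y = c y z ∧ c x y = c x z := by
  classical
  obtain ⟨b, S, hS, hadj, hcol⟩ := hG c hc
  obtain ⟨x, y, z, hxy, hxz, hyz, rfl⟩ := Finset.card_eq_three.mp hS
  have hx : x ∈ ({x, y, z} : Finset V) := by simp
  have hy : y ∈ ({x, y, z} : Finset V) := by simp
  have hz : z ∈ ({x, y, z} : Finset V) := by simp
  exact ⟨x, y, z, hadj x hx y hy hxy, hadj y hy z hz hyz, hadj x hx z hz hxz,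
    (hcol x hx y hy hxy).trans (hcol y hy z hz hyz).symm,
    (hcol x hx y hy hxy).trans (hcol x hx z hz hxz).symm⟩

lemma isMonoClique_pair {V : Type*} [DecidableEq V] {G : SimpleGraph V} {c : V → V → Bool}
    (hc : ∀ x y, c x y = c y x) {b : Bool} {x y : V} (hxy : G.Adj x y) (h : c x y = b) :
    IsMonoClique G c b 2 {x, y} := by
  refine ⟨Finset.card_pair hxy.ne, ?_, ?_⟩ <;>
    grind [SimpleGraph.adj_comm]

lemma isMonoClique_triple {V : Type*} [DecidableEq V] {G : SimpleGraph V} {c : V → V → Bool}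
    (hc : ∀ x y, c x y = c y x) {b : Bool} {x y z : V}
    (hxy : G.Adj x y) (hyz : G.Adj y z) (hxz : G.Adj x z)
    (h₁ : c x y = b) (h₂ : c y z = b) (h₃ : c x z = b) :
    IsMonoClique G c b 3 {x, y, z} := by
  refine ⟨Finset.card_eq_three.mpr ⟨x, y, z, hxy.ne, hxz.ne, hyz.ne, rfl⟩, ?_, ?_⟩ <;>
    grind [SimpleGraph.adj_comm]

/-- A graph that becomes triangle-free after deleting two vertices is not Ramsey for `K 3`. -/
lemma not_isRamseyFor_three_of_delete_pair {V : Type*} {G : SimpleGraph V} (a b : V)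
    (h : ∀ x y z, x ≠ a → x ≠ b → y ≠ a → y ≠ b → z ≠ a → z ≠ b →
      G.Adj x y → G.Adj y z → ¬ G.Adj x z) :
    ¬ IsRamseyFor G 3 := by
  classical
  intro hG
  obtain ⟨x, y, z, hxy, hyz, hxz, h₁, h₂⟩ := hG.exists_triangle
    (fun x y => xor (decide (x = a ∨ x = b)) (decide (y = a ∨ y = b)))
    (fun x y => Bool.xor_comm _ _)
  have := hxy.ne
  have := hyz.ne
  have := hxz.ne
  have := h x y z
  by_cases hx : x = a ∨ x = b <;> by_cases hy : y = a ∨ y = b <;>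
    by_cases hz : z = a ∨ z = b <;> simp [hx, hy, hz] at h₁ h₂ <;> grind

/-- The colouring of `K 5` by two 5-cycles, without monochromatic triangle. -/
def pentagonColour (i j : Fin 5) : Bool := decide (i - j = 1 ∨ j - i = 1)

lemma pentagonColour_comm (i j : Fin 5) : pentagonColour i j = pentagonColour j i := by
  simp [pentagonColour, or_comm]

lemma pentagonColour_no_triangle : ∀ i j k : Fin 5, i ≠ j → j ≠ k → i ≠ k →
    pentagonColour i j = pentagonColour j k → pentagonColour i j ≠ pentagonColour i k := by
  decide

/-- If `G` is triangle-free off `T`, and is 5-colourable after deleting vertices outside `T`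
with at most one neighbour in `T`, then `G` is not Ramsey for `K 3`. -/
lemma not_isRamseyFor_three_of_colouring {V : Type*} {G : SimpleGraph V} (T P : Set V)
    (hT : ∀ x y z, x ∉ T → y ∉ T → z ∉ T → G.Adj x y → G.Adj y z → ¬ G.Adj x z)
    (hPT : ∀ p ∈ P, p ∉ T)
    (hP : ∀ p ∈ P, ∀ s ∈ T, ∀ t ∈ T, G.Adj p s → G.Adj p t → s = t)
    (f : V → Fin 5) (hf : ∀ x y, x ∉ P → y ∉ P → G.Adj x y → f x ≠ f y) :
    ¬ IsRamseyFor G 3 := by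
  classical
  intro hG
  obtain ⟨x, y, z, hxy, hyz, hxz, h₁, h₂⟩ := hG.exists_triangle
    (fun x y => if x ∈ P ∨ y ∈ P then decide (x ∈ T ∨ y ∈ T) else pentagonColour (f x) (f y))
    (fun x y => by simp only [or_comm, pentagonColour_comm])
  have hyx := hxy.symm
  have hzy := hyz.symm
  have hzx := hxz.symm
  have nxy := hxy.ne
  have nyz := hyz.ne
  have nxz := hxz.ne
  have key := hT x y z
  by_cases hx : x ∈ P
  · have hne := hP x hx y
    simp only [hx, hPT x hx, true_or, false_or, if_true, decide_eq_decide] at h₂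
    by_cases hyT : y ∈ T
    · exact nyz (hne hyT z (h₂.1 hyT) hxy hxz)
    · exact key (by grind) (by grind) (by grind) hxy hyz hxz
  by_cases hy : y ∈ P
  · have hne := hP y hy x
    simp only [hy, hPT y hy, true_or, or_true, false_or, or_false, if_true,
      decide_eq_decide] at h₁
    by_cases hxT : x ∈ T
    · exact nxz (hne hxT z (h₁.1 hxT) hyx hyz)
    · exact key (by grind) (by grind) (by grind) hxy hyz hxz
  by_cases hz : z ∈ P
  · have h₃ := h₁.symm.trans h₂
    have hne := hP z hz x
    simp only [hz, hPT z hz, or_true, or_false, if_true, decide_eq_decide] at h₃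
    by_cases hxT : x ∈ T
    · exact nxy (hne hxT y (h₃.2 hxT) hzx hzy)
    · exact key (by grind) (by grind) (by grind) hxy hyz hxz
  simp only [hx, hy, hz, or_self, if_false] at h₁ h₂
  exact pentagonColour_no_triangle _ _ _ (hf x y hx hy hxy) (hf y z hy hz hyz)
    (hf x z hx hz hxz) h₁ h₂

/-- If the edges of `G` are split into `R` and `B`, where `B` is triangle-free and every edge of
`R` meets every triangle of `R`, of which there is at least one, then `G` is not Ramsey for
`K 3`. -/
lemma not_isRamseyFor_three_of_edges_meet_triangles {V : Type*} {G : SimpleGraph V}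
    (R B : V → V → Prop) (hRs : ∀ x y, R x y → R y x) (hBs : ∀ x y, B x y → B y x)
    (hadj : ∀ x y, G.Adj x y ↔ R x y ∨ B x y)
    (hR : ∀ x y z u v, R x y → R y z → R x z → R u v →
      u = x ∨ u = y ∨ u = z ∨ v = x ∨ v = y ∨ v = z)
    (hB : ∀ x y z, B x y → B y z → ¬ B x z)
    {a b d : V} (hab : R a b) (hbd : R b d) (had : R a d) :
    ¬ IsRamseyFor G 3 := by
  classical
  have irr : ∀ x, ¬ R x x ∧ ¬ B x x := fun x =>
    ⟨fun h => G.loopless.irrefl x ((hadj x x).2 (.inl h)),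
      fun h => G.loopless.irrefl x ((hadj x x).2 (.inr h))⟩
  have nab : a ≠ b := fun h => (irr b).1 (h ▸ hab)
  have nbd : b ≠ d := fun h => (irr d).1 (h ▸ hbd)
  have nad : a ≠ d := fun h => (irr d).1 (h ▸ had)
  have pair : ∀ p q s u, R p q → R q s → R p s → R u p → R u q → ¬ R u s → u ≠ s →
      ¬ IsRamseyFor G 3 := by
    intro p q s u hpq hqs hps hup huq hus hne
    apply not_isRamseyFor_three_of_delete_pair p q
    have red : ∀ x y, x ≠ p → x ≠ q → y ≠ p → y ≠ q → ¬ R x y := by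
      intro x y h₁ h₂ h₃ h₄ h
      have := hR p q s x y hpq hqs hps h
      have := hR p q u x y hpq (hRs _ _ huq) (hRs _ _ hup) h
      grind
    intro x y z h₁ h₂ h₃ h₄ h₅ h₆ hxy hyz hxz
    exact hB x y z (((hadj x y).1 hxy).resolve_left (red x y h₁ h₂ h₃ h₄))
      (((hadj y z).1 hyz).resolve_left (red y z h₃ h₄ h₅ h₆))
      (((hadj x z).1 hxz).resolve_left (red x z h₁ h₂ h₅ h₆))
  let T : Set V := {a, b, d}
  let P : Set V := {v | v ∉ T ∧ ∀ s ∈ T, ∀ t ∈ T, G.Adj v s → G.Adj v t → s = t}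
  have hT : ∀ x y z, x ∉ T → y ∉ T → z ∉ T → G.Adj x y → G.Adj y z → ¬ G.Adj x z := by
    have red : ∀ x y, x ∉ T → y ∉ T → ¬ R x y := by
      intro x y hx hy h
      have := hR a b d x y hab hbd had h
      simp only [T, Set.mem_insert_iff, Set.mem_singleton_iff] at hx hy
      grind
    intro x y z hx hy hz hxy hyz hxz
    exact hB x y z (((hadj x y).1 hxy).resolve_left (red x y hx hy))
      (((hadj y z).1 hyz).resolve_left (red y z hy hz))
      (((hadj x z).1 hxz).resolve_left (red x z hx hz))
  have hPnot : ∀ v, v ∉ P → v = a ∨ v = b ∨ v = d ∨ ((R v a ∨ B v a) ∧ (R v b ∨ B v b)) ∨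
      ((R v b ∨ B v b) ∧ (R v d ∨ B v d)) ∨ ((R v a ∨ B v a) ∧ (R v d ∨ B v d)) := by
    intro v hv
    simp only [← hadj]
    by_contra! h
    apply hv
    simp only [P, T, Set.mem_ofPred_eq, Set.mem_insert_iff, Set.mem_singleton_iff]
    grind
  by_cases hu : ∃ u, u ≠ a ∧ u ≠ b ∧ u ≠ d ∧
      ((R u a ∧ R u b) ∨ (R u b ∧ R u d) ∨ (R u a ∧ R u d))
  · obtain ⟨u, hua, hub, hud, h⟩ := hu
    by_cases hall : R u a ∧ R u b ∧ R u d
    · obtain ⟨ra, rb, rd⟩ := hall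
      refine not_isRamseyFor_three_of_colouring T P hT (fun p hp => hp.1) (fun p hp => hp.2)
        (fun v => if v = a then 0 else if v = b then 1 else if v = d then 2 else
          if v = u then 3 else if B v a then 4 else 0) ?_
      have out : ∀ v, v ≠ a → v ≠ b → v ≠ d → v ≠ u → ¬ R v a ∧ ¬ R v b ∧ ¬ R v d := by
        intro v h₁ h₂ h₃ h₄
        have := hR u b d v a rb hbd rd
        have := hR u a d v b ra had rd
        have := hR u a b v d ra hab rb
        grind
      intro x y hx hy hxy
      have hne := hxy.ne
      rw [hadj] at hxy
      have := hPnot x hx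
      have := hPnot y hy
      have := out x
      have := out y
      have := hB x y a
      have := hB x y b
      have := hB x y d
      have := hR a b d x y hab hbd had
      grind
    · by_cases h₁ : R u a ∧ R u b
      · exact pair a b d u hab hbd had h₁.1 h₁.2 (by tauto) hud
      by_cases h₂ : R u b ∧ R u d
      · exact pair b d a u hbd (hRs _ _ had) (hRs _ _ hab) h₂.1 h₂.2 (by tauto) hua
      · exact pair a d b u had (hRs _ _ hbd) hab (by tauto) (by tauto) (by tauto) hub
  · refine not_isRamseyFor_three_of_colouring T P hT (fun p hp => hp.1) (fun p hp => hp.2)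
      (fun v => if v = a then 0 else if v = b then 1 else if v = d then 2 else
        if B v a then 3 else if B v d then 4 else if R v a then 2 else 0) ?_
    push Not at hu
    have kind : ∀ v, v ∉ P → v = a ∨ v = b ∨ v = d ∨ B v a ∨ B v d ∨
        (B v b ∧ R v a ∧ ¬ R v d) ∨ (B v b ∧ ¬ R v a) := by
      intro v hv
      have := hPnot v hv
      have := hu v
      clear hPnot hu hT pair hR hB hadj hRs hBs
      grind
    intro x y hx hy hxy
    have hne := hxy.ne
    rw [hadj] at hxy
    replace hx := kind x hx
    replace hy := kind y hy
    have := hB x y a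
    have := hB x y b
    have := hB x y d
    have := hR a b d x y hab hbd had
    have := hRs x y
    have := hRs d
    have := hRs a
    have := hBs a
    have := hBs d
    clear hPnot hu hT pair hR hB hadj hRs hBs kind
    clear P T
    grind (splits := 30)

theorem red_and_blue_K3 {α : Type*} [Fintype α] (G : SimpleGraph α)
    (hG : IsRamseyFor G 3)
    (c : α → α → Bool) (hc : ∀ u v, c u v = c v u)
    (hno : ¬ ∃ b S T, Disjoint S T ∧ IsMonoClique G c b 3 S ∧ IsMonoClique G c b 2 T) :
    (∃ S, IsMonoClique G c true 3 S) ∧ (∃ T, IsMonoClique G c false 3 T) := by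
  classical
  have key : ∀ r, ∃ S, IsMonoClique G c r 3 S := by
    intro r
    by_contra hr
    obtain ⟨a, b, d, hab, hbd, had, h₁, h₂⟩ := hG.exists_triangle c hc
    have hk : c a b = !r := by
      by_contra h
      have h : c a b = r := by simpa using h
      exact hr ⟨_, isMonoClique_triple hc hab hbd had h (h₁ ▸ h) (h₂ ▸ h)⟩
    refine not_isRamseyFor_three_of_edges_meet_triangles
      (fun x y => G.Adj x y ∧ c x y = !r) (fun x y => G.Adj x y ∧ c x y = r)
      (fun x y h => ⟨h.1.symm, hc x y ▸ h.2⟩) (fun x y h => ⟨h.1.symm, hc x y ▸ h.2⟩)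
      ?_ ?_ ?_ ⟨hab, hk⟩ ⟨hbd, h₁ ▸ hk⟩ ⟨had, h₂ ▸ hk⟩ hG
    · intro x y
      cases c x y <;> cases r <;> simp
    · intro x y z u v hxy hyz hxz huv
      by_contra! h
      refine hno ⟨!r, {x, y, z}, {u, v}, ?_,
        isMonoClique_triple hc hxy.1 hyz.1 hxz.1 hxy.2 hyz.2 hxz.2,
        isMonoClique_pair hc huv.1 huv.2⟩
      rw [Finset.disjoint_left]
      grind
    · intro x y z hxy hyz hxz
      exact hr ⟨_, isMonoClique_triple hc hxy.1 hyz.1 hxz.1 hxy.2 hyz.2 hxz.2⟩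
  exact ⟨key true, key false⟩
end

section
/- Let G be a finite simple graph that is Ramsey for K_3, and suppose a 2-colouring of the edges of G contains no monochromatic copy of K_3 + K_2. Then there exist two disjoint vertex sets V_R and V_B such that V_R is a monochromatic K_3 in colour red and V_B is a monochromatic K_3 in colour blue. -/
open Finset

/-- Three vertices that are pairwise related by `r`. -/
def IsTriangle {V : Type*} (r : V → V → Prop) (x y z : V) : Prop :=
  r x y ∧ r x z ∧ r y z

theorem isMonoClique_three_iff {V : Type*} (G : SimpleGraph V) (c : V → V → Bool)
    (hc : ∀ u v, c u v = c v u) (b : Bool) (S : Finset V) :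
    IsMonoClique G c b 3 S ↔
      ∃ x y z, IsTriangle (fun u v => G.Adj u v ∧ c u v = b) x y z ∧
        ∀ v, v ∈ S ↔ v = x ∨ v = y ∨ v = z := by
  classical
  constructor
  · rintro ⟨hcard, hadj, hcol⟩
    obtain ⟨x, y, z, hxy, hxz, hyz, rfl⟩ := Finset.card_eq_three.mp hcard
    refine ⟨x, y, z, ⟨⟨hadj _ ?_ _ ?_ hxy, hcol _ ?_ _ ?_ hxy⟩,
      ⟨hadj _ ?_ _ ?_ hxz, hcol _ ?_ _ ?_ hxz⟩,
      ⟨hadj _ ?_ _ ?_ hyz, hcol _ ?_ _ ?_ hyz⟩⟩, ?_⟩ <;> simp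
  · rintro ⟨x, y, z, ⟨⟨hxy, hxy'⟩, ⟨hxz, hxz'⟩, hyz, hyz'⟩, hS⟩
    obtain rfl : S = {x, y, z} := by ext v; simp [hS]
    refine ⟨Finset.card_eq_three.mpr ⟨x, y, z, hxy.ne, hxz.ne, hyz.ne, rfl⟩, ?_, ?_⟩
    · have := hxy.symm
      have := hxz.symm
      have := hyz.symm
      intro u hu v hv huv
      rw [hS] at hu hv
      rcases hu with rfl | rfl | rfl <;> rcases hv with rfl | rfl | rfl <;>
        first | assumption | exact absurd rfl huv
    · intro u hu v hv huv
      rw [hS] at hu hv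
      rcases hu with rfl | rfl | rfl <;> rcases hv with rfl | rfl | rfl <;>
        first | exact absurd rfl huv | assumption | (rw [hc]; assumption)

set_option maxHeartbeats 1000000 in
/-- If every triangle of `G` meets `{a, b, c}`, a 2-colouring of the edges between `{a, b, c}` and
the other vertices (`ra`, `rb`, `rc` single out the red ones) extends to a colouring of `G` without
monochromatic triangles as soon as it is compatible with colouring `ab` blue and `ac`, `bc` red, and
no two adjacent outer vertices have both a common red and a common blue neighbour. -/
theorem not_isRamseyFor_three_of_outer_coloring {V : Type*} (G : SimpleGraph V) (a b c : V)
    (hab : a ≠ b) (hac : a ≠ c) (hbc : b ≠ c) (ra rb rc : V → Prop)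
    (meets : ∀ x y z, x ≠ a → x ≠ b → x ≠ c → y ≠ a → y ≠ b → y ≠ c → z ≠ a → z ≠ b → z ≠ c →
      ¬ IsTriangle G.Adj x y z)
    (outer_ab : ∀ v, v ≠ a → v ≠ b → v ≠ c → G.Adj v a → G.Adj v b → ra v ∨ rb v)
    (outer_ac : ∀ v, v ≠ a → v ≠ b → v ≠ c → G.Adj v a → G.Adj v c → ¬ (ra v ∧ rc v))
    (outer_bc : ∀ v, v ≠ a → v ≠ b → v ≠ c → G.Adj v b → G.Adj v c → ¬ (rb v ∧ rc v))
    (common : ∀ u v, u ≠ a → u ≠ b → u ≠ c → v ≠ a → v ≠ b → v ≠ c → G.Adj u v →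
      ((G.Adj u a ∧ G.Adj v a ∧ ra u ∧ ra v) ∨ (G.Adj u b ∧ G.Adj v b ∧ rb u ∧ rb v) ∨
        (G.Adj u c ∧ G.Adj v c ∧ rc u ∧ rc v)) →
      ((G.Adj u a ∧ G.Adj v a ∧ ¬ ra u ∧ ¬ ra v) ∨ (G.Adj u b ∧ G.Adj v b ∧ ¬ rb u ∧ ¬ rb v) ∨
        (G.Adj u c ∧ G.Adj v c ∧ ¬ rc u ∧ ¬ rc v)) → False) :
    ¬ IsRamseyFor G 3 := by
  classical
  intro hG
  let K : V → V → Prop := fun u v =>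
    (G.Adj u a ∧ G.Adj v a ∧ ¬ ra u ∧ ¬ ra v) ∨ (G.Adj u b ∧ G.Adj v b ∧ ¬ rb u ∧ ¬ rb v) ∨
        (G.Adj u c ∧ G.Adj v c ∧ ¬ rc u ∧ ¬ rc v)
  let D : V → V → Prop := fun x y => (x = a ∧ y = c) ∨ (x = b ∧ y = c) ∨
    (x ≠ a ∧ x ≠ b ∧ x ≠ c ∧ ((y = a ∧ ra x) ∨ (y = b ∧ rb x) ∨ (y = c ∧ rc x) ∨
      (y ≠ a ∧ y ≠ b ∧ y ≠ c ∧ K x y)))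
  let col : V → V → Bool := fun x y => decide (D x y ∨ D y x)
  have col_comm : ∀ x y, col x y = col y x := fun x y => decide_eq_decide.mpr or_comm
  have col_ab : col a b = false := by simp [col, D, hab, hac, hbc, hab.symm]
  have col_ac : col a c = true := by simp [col, D]
  have col_bc : col b c = true := by simp [col, D]
  have col_a : ∀ v, v ≠ a → v ≠ b → v ≠ c → (col v a = true ↔ ra v) := by
    intro v h1 h2 h3
    simp [col, D, h1, h2, h3, hab, hac]
  have col_b : ∀ v, v ≠ a → v ≠ b → v ≠ c → (col v b = true ↔ rb v) := by
    intro v h1 h2 h3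
    simp [col, D, h1, h2, h3, hbc, hab.symm]
  have col_c : ∀ v, v ≠ a → v ≠ b → v ≠ c → (col v c = true ↔ rc v) := by
    intro v h1 h2 h3
    simp [col, D, h1, h2, h3, hac.symm, hbc.symm]
  have col_outer : ∀ u v, u ≠ a → u ≠ b → u ≠ c → v ≠ a → v ≠ b → v ≠ c →
      (col u v = true ↔ K u v) := by
    intro u v h1 h2 h3 h4 h5 h6
    have : K v u ↔ K u v := by simp only [K]; tauto
    simp [col, D, h1, h2, h3, h4, h5, h6, this]
  have outer_edge : ∀ u v t β, u ≠ a → u ≠ b → u ≠ c → v ≠ a → v ≠ b → v ≠ c →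
      (t = a ∨ t = b ∨ t = c) → G.Adj u v → G.Adj u t → G.Adj v t →
      col u v = β → col u t = β → col v t = β → False := by
    intro u v t β _ _ _ _ _ _ ht huv hut hvt h1 h2 h3
    have := common u v
    have := col_outer u v
    clear_value col
    rcases ht with rfl | rfl | rfl <;> cases β <;> grind
  have inner_edge : ∀ v s t β, v ≠ a → v ≠ b → v ≠ c → (s = a ∨ s = b ∨ s = c) →
      (t = a ∨ t = b ∨ t = c) → s ≠ t → G.Adj v s → G.Adj v t →
      col s t = β → col v s = β → col v t = β → False := by
    intro v s t β _ _ _ hs ht hst hvs hvt h1 h2 h3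
    have := outer_ab v
    have := outer_ac v
    have := outer_bc v
    have := col_a v
    have := col_b v
    have := col_c v
    have := col_comm s t
    clear_value col
    clear common meets outer_ab outer_ac outer_bc outer_edge col_outer col_comm
    rcases hs with rfl | rfl | rfl <;> rcases ht with rfl | rfl | rfl <;> cases β <;> grind
  obtain ⟨β, S, hS⟩ := hG col col_comm
  rw [isMonoClique_three_iff G col col_comm] at hS
  obtain ⟨x, y, z, ⟨⟨hxy, hxy'⟩, ⟨hxz, hxz'⟩, hyz, hyz'⟩, -⟩ := hS
  have := hxy.ne
  have := hxz.ne
  have := hyz.ne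
  have := hxy.symm
  have := hxz.symm
  have := hyz.symm
  have hyx' := (col_comm y x).trans hxy'
  have hzx' := (col_comm z x).trans hxz'
  have hzy' := (col_comm z y).trans hyz'
  have := col_comm a b
  have := col_comm a c
  have := col_comm b c
  have hx : (x = a ∨ x = b ∨ x = c) ∨ (x ≠ a ∧ x ≠ b ∧ x ≠ c) := by tauto
  have hy : (y = a ∨ y = b ∨ y = c) ∨ (y ≠ a ∧ y ≠ b ∧ y ≠ c) := by tauto
  have hz : (z = a ∨ z = b ∨ z = c) ∨ (z ≠ a ∧ z ≠ b ∧ z ≠ c) := by tauto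
  clear_value col
  rcases hx with hx | ⟨hx1, hx2, hx3⟩ <;> rcases hy with hy | ⟨hy1, hy2, hy3⟩ <;>
    rcases hz with hz | ⟨hz1, hz2, hz3⟩
  · clear outer_edge inner_edge common meets outer_ab outer_ac outer_bc col_outer
    grind
  · exact inner_edge z x y β hz1 hz2 hz3 hx hy ‹_› ‹_› ‹_›
      ‹_› ‹_› ‹_›
  · exact inner_edge y x z β hy1 hy2 hy3 hx hz ‹_› ‹_› ‹_›
      ‹_› ‹_› ‹_›
  · exact outer_edge y z x β hy1 hy2 hy3 hz1 hz2 hz3 hx ‹_› ‹_› ‹_›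
      ‹_› ‹_› ‹_›
  · exact inner_edge x y z β hx1 hx2 hx3 hy hz ‹_› ‹_› ‹_›
      ‹_› ‹_› ‹_›
  · exact outer_edge x z y β hx1 hx2 hx3 hz1 hz2 hz3 hy ‹_› ‹_› ‹_›
      ‹_› ‹_› ‹_›
  · exact outer_edge x y z β hx1 hx2 hx3 hy1 hy2 hy3 hz ‹_› ‹_› ‹_›
      ‹_› ‹_› ‹_›
  · exact meets x y z hx1 hx2 hx3 hy1 hy2 hy3 hz1 hz2 hz3 ⟨hxy, hxz, hyz⟩

/-- The edges of `G` are split into two classes `r` and `s`, every triangle inside one class meets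
all edges of that class, and any two triangles from different classes meet. -/
structure IsIntersectingSplit {V : Type*} (G : SimpleGraph V) (r s : V → V → Prop) : Prop where
  adj_iff : ∀ x y, G.Adj x y ↔ r x y ∨ s x y
  not_both : ∀ x y, r x y → ¬ s x y
  symm_left : ∀ x y, r x y → r y x
  symm_right : ∀ x y, s x y → s y x
  edge_left : ∀ x y z u v, IsTriangle r x y z → r u v →
    (u = x ∨ u = y ∨ u = z) ∨ (v = x ∨ v = y ∨ v = z)
  edge_right : ∀ x y z u v, IsTriangle s x y z → s u v →
    (u = x ∨ u = y ∨ u = z) ∨ (v = x ∨ v = y ∨ v = z)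
  triangle_meet : ∀ x y z u v w, IsTriangle r x y z → IsTriangle s u v w →
    (u = x ∨ u = y ∨ u = z) ∨ (v = x ∨ v = y ∨ v = z) ∨ (w = x ∨ w = y ∨ w = z)

namespace IsIntersectingSplit

variable {V : Type*} {G : SimpleGraph V} {r s : V → V → Prop}

theorem outer_edge (h : IsIntersectingSplit G r s) {a b c : V} (habc : IsTriangle r a b c)
    (u v : V) (hua : u ≠ a) (hub : u ≠ b) (huc : u ≠ c) (hva : v ≠ a) (hvb : v ≠ b) (hvc : v ≠ c)
    (huv : G.Adj u v) : s u v := by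
  have := h.edge_left a b c u v habc
  have := h.adj_iff u v
  tauto

theorem triangle_meets (h : IsIntersectingSplit G r s) {a b c : V} (habc : IsTriangle r a b c)
    (x y z : V) (hxa : x ≠ a) (hxb : x ≠ b) (hxc : x ≠ c) (hya : y ≠ a) (hyb : y ≠ b) (hyc : y ≠ c)
    (hza : z ≠ a) (hzb : z ≠ b) (hzc : z ≠ c) : ¬ IsTriangle G.Adj x y z := by
  rintro ⟨hxy, hxz, hyz⟩
  have := h.triangle_meet a b c x y z habc
    ⟨h.outer_edge habc x y hxa hxb hxc hya hyb hyc hxy,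
      h.outer_edge habc x z hxa hxb hxc hza hzb hzc hxz,
      h.outer_edge habc y z hya hyb hyc hza hzb hzc hyz⟩
  tauto

theorem ne_of_left (h : IsIntersectingSplit G r s) {x y : V} (hxy : r x y) : x ≠ y :=
  ((h.adj_iff x y).mpr (Or.inl hxy)).ne

theorem ne_of_right (h : IsIntersectingSplit G r s) {x y : V} (hxy : s x y) : x ≠ y :=
  ((h.adj_iff x y).mpr (Or.inr hxy)).ne

/-- Triangles of different classes that share a vertex. -/
theorem not_isRamseyFor_of_bowtie (h : IsIntersectingSplit G r s) {a b c d e : V}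
    (habc : IsTriangle r a b c) (hade : IsTriangle s a d e) : ¬ IsRamseyFor G 3 := by
  obtain ⟨hab, hac, hbc⟩ := id habc
  obtain ⟨had, hae, hde⟩ := id hade
  have hbca : IsTriangle r b c a := ⟨hbc, h.symm_left _ _ hab, h.symm_left _ _ hac⟩
  have ab := h.ne_of_left hab
  have ac := h.ne_of_left hac
  have bc := h.ne_of_left hbc
  have ad := h.ne_of_right had
  have ae := h.ne_of_right hae
  have de := h.ne_of_right hde
  refine not_isRamseyFor_three_of_outer_coloring G b c a bc ab.symm ac.symm
    (fun v => v = d) (fun v => v = e) (fun v => v ≠ d ∧ v ≠ e) (h.triangle_meets hbca)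
    ?_ ?_ ?_ ?_
  · intro v hb hc ha hvb hvc
    by_contra! hv
    have hvb' : r b v := by
      have := h.edge_right a d e v b hade
      have := h.adj_iff v b
      have := h.symm_left v b
      have := h.not_both a b
      grind
    have hvc' : r c v := by
      have := h.edge_right a d e v c hade
      have := h.adj_iff v c
      have := h.symm_left v c
      have := h.not_both a c
      grind
    have := h.triangle_meet b c v a d e ⟨hbc, hvb', hvc'⟩ hade
    have := h.not_both a b
    have := h.not_both a c
    grind
  · tauto
  · tauto
  · intro u v hub huc hua hvb hvc hva huv h1 h2
    have := h.outer_edge hbca u v hub huc hua hvb hvc hva huv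
    have := h.edge_right a d e u v hade this
    have := huv.ne
    grind

/-- The second class has no triangle, and the first has two triangles `abc`, `abw` with a common
edge. -/
theorem not_isRamseyFor_of_shared_edge (h : IsIntersectingSplit G r s) {a b c w : V}
    (habc : IsTriangle r a b c) (hwc : w ≠ c) (hwa : r w a) (hwb : r w b)
    (hs : ∀ x y z, ¬ IsTriangle s x y z) : ¬ IsRamseyFor G 3 := by
  obtain ⟨hab, hac, hbc⟩ := id habc
  have ab := h.ne_of_left hab
  have ac := h.ne_of_left hac
  have bc := h.ne_of_left hbc
  have wa := h.ne_of_left hwa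
  have wb := h.ne_of_left hwb
  have habw : IsTriangle r a b w := ⟨hab, h.symm_left _ _ hwa, h.symm_left _ _ hwb⟩
  have other : ∀ v, v ≠ a → v ≠ b → v ≠ w → ¬ r v c := fun v hva hvb hvw hvc => by
    have := h.edge_left a b w v c habw hvc
    grind
  have no_common : ∀ u v t, s u v → s u t → s v t → False :=
    fun u v t h1 h2 h3 => hs u v t ⟨h1, h2, h3⟩
  by_cases hc : r w c
  · have hacw : IsTriangle r a c w := ⟨hac, h.symm_left _ _ hwa, h.symm_left _ _ hc⟩
    have hbcw : IsTriangle r b c w := ⟨hbc, h.symm_left _ _ hwb, h.symm_left _ _ hc⟩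
    have other_a : ∀ v, v ≠ b → v ≠ c → v ≠ w → ¬ r v a := fun v hvb hvc hvw hva => by
      have := h.edge_left b c w v a hbcw hva
      grind
    have other_b : ∀ v, v ≠ a → v ≠ c → v ≠ w → ¬ r v b := fun v hva hvc hvw hvb => by
      have := h.edge_left a c w v b hacw hvb
      grind
    refine not_isRamseyFor_three_of_outer_coloring G a b c ab ac bc
      (fun v => v ≠ w) (fun v => v = w) (fun _ => False) (h.triangle_meets habc) ?_ ?_ ?_ ?_
    · tauto
    · tauto
    · tauto
    · intro u v hua hub huc hva hvb hvc huv h1 h2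
      have := h.outer_edge habc u v hua hub huc hva hvb hvc huv
      have := huv.ne
      have := no_common u v b
      have := no_common u v c
      have := h.adj_iff
      grind
  · have other' : ∀ v, v ≠ a → v ≠ b → ¬ r v c := by grind
    refine not_isRamseyFor_three_of_outer_coloring G a b c ab ac bc
      (fun v => r v a ∨ s v b) (fun v => ¬ s v b) (fun _ => False) (h.triangle_meets habc)
      ?_ ?_ ?_ ?_
    · tauto
    · tauto
    · tauto
    · intro u v hua hub huc hva hvb hvc huv h1 h2
      have := h.outer_edge habc u v hua hub huc hva hvb hvc huv
      have := no_common u v a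
      have := no_common u v b
      have := no_common u v c
      have := h.adj_iff
      grind

/-- The second class has no triangle, and no other triangle of the first class shares an edge
with `abc`. -/
theorem not_isRamseyFor_of_isolated_triangle (h : IsIntersectingSplit G r s) {a b c : V}
    (habc : IsTriangle r a b c) (hs : ∀ x y z, ¬ IsTriangle s x y z)
    (hab' : ∀ v, v ≠ c → r v a → ¬ r v b) (hac' : ∀ v, v ≠ b → r v a → ¬ r v c)
    (hbc' : ∀ v, v ≠ a → r v b → ¬ r v c) : ¬ IsRamseyFor G 3 := by
  obtain ⟨hab, hac, hbc⟩ := id habc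
  have no_common : ∀ u v t, s u v → s u t → s v t → False :=
    fun u v t h1 h2 h3 => hs u v t ⟨h1, h2, h3⟩
  refine not_isRamseyFor_three_of_outer_coloring G a b c
    (h.ne_of_left hab) (h.ne_of_left hac) (h.ne_of_left hbc)
    (fun v => ¬ (r v a ∧ s v c)) (fun v => ¬ (r v b ∧ s v c))
    (fun v => ¬ (G.Adj v a ∧ ¬ (r v a ∧ s v c)) ∧ ¬ (G.Adj v b ∧ ¬ (r v b ∧ s v c)))
    (h.triangle_meets habc) ?_ ?_ ?_ ?_
  · grind
  · grind
  · grind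
  · intro u v hua hub huc hva hvb hvc huv h1 h2
    have := h.outer_edge habc u v hua hub huc hva hvb hvc huv
    have := no_common u v a
    have := no_common u v b
    have := no_common u v c
    have := h.adj_iff u a
    have := h.adj_iff u b
    have := h.adj_iff u c
    have := h.adj_iff v a
    have := h.adj_iff v b
    have := h.adj_iff v c
    have := h.not_both u a
    have := h.not_both u b
    have := h.not_both u c
    have := h.not_both v a
    have := h.not_both v b
    have := h.not_both v c
    have := hab' u huc
    have := hac' u hub
    have := hbc' u hua
    have := hab' v hvc
    have := hac' v hvb
    have := hbc' v hva
    clear no_common hab' hac' hbc' hs h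
    grind

theorem not_isRamseyFor (h : IsIntersectingSplit G r s) {a b c : V}
    (habc : IsTriangle r a b c) : ¬ IsRamseyFor G 3 := by
  obtain ⟨hab, hac, hbc⟩ := id habc
  have hba := h.symm_left _ _ hab
  have hca := h.symm_left _ _ hac
  have hcb := h.symm_left _ _ hbc
  by_cases hs : ∃ d e f, IsTriangle s d e f
  · obtain ⟨d, e, f, hdef⟩ := hs
    obtain ⟨hde, hdf, hef⟩ := id hdef
    have hed := h.symm_right _ _ hde
    have hfd := h.symm_right _ _ hdf
    have hfe := h.symm_right _ _ hef
    have base : ∀ t, t = a ∨ t = b ∨ t = c → ∃ p q, IsTriangle r t p q := by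
      rintro t (rfl | rfl | rfl)
      exacts [⟨b, c, hab, hac, hbc⟩, ⟨a, c, hba, hbc, hac⟩, ⟨a, b, hca, hcb, hab⟩]
    rcases h.triangle_meet a b c d e f habc hdef with ht | ht | ht <;>
      obtain ⟨p, q, hpq⟩ := base _ ht
    · exact h.not_isRamseyFor_of_bowtie hpq ⟨hde, hdf, hef⟩
    · exact h.not_isRamseyFor_of_bowtie hpq ⟨hed, hef, hdf⟩
    · exact h.not_isRamseyFor_of_bowtie hpq ⟨hfd, hfe, hde⟩
  · have hs : ∀ x y z, ¬ IsTriangle s x y z := fun x y z hxyz => hs ⟨x, y, z, hxyz⟩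
    intro hG
    exact h.not_isRamseyFor_of_isolated_triangle habc hs
      (fun v hv hva hvb => h.not_isRamseyFor_of_shared_edge ⟨hab, hac, hbc⟩ hv hva hvb hs hG)
      (fun v hv hva hvc => h.not_isRamseyFor_of_shared_edge ⟨hac, hab, hcb⟩ hv hva hvc hs hG)
      (fun v hv hvb hvc => h.not_isRamseyFor_of_shared_edge ⟨hbc, hba, hca⟩ hv hvb hvc hs hG) hG

end IsIntersectingSplit

theorem IsTriangle.meets_edge_of_no_pair {V : Type*} {G : SimpleGraph V} {c : V → V → Bool}
    (hc : ∀ u v, c u v = c v u)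
    (hno : ¬ ∃ b S T, Disjoint S T ∧ IsMonoClique G c b 3 S ∧ IsMonoClique G c b 2 T)
    (b : Bool) (x y z u v : V) (hxyz : IsTriangle (fun u v => G.Adj u v ∧ c u v = b) x y z)
    (huv : G.Adj u v ∧ c u v = b) :
    (u = x ∨ u = y ∨ u = z) ∨ (v = x ∨ v = y ∨ v = z) := by
  classical
  by_contra hmeet
  refine hno ⟨b, {x, y, z}, {u, v}, ?_, ?_, Finset.card_pair huv.1.ne, ?_, ?_⟩
  · rw [Finset.disjoint_left]
    simp only [Finset.mem_insert, Finset.mem_singleton]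
    grind
  · exact (isMonoClique_three_iff G c hc b _).mpr ⟨x, y, z, hxyz, by simp⟩
  · have := huv.1.symm
    simp only [Finset.mem_insert, Finset.mem_singleton]
    grind
  · have := hc u v
    simp only [Finset.mem_insert, Finset.mem_singleton]
    grind

theorem disjoint_red_and_blue_K3 {α : Type*} [Fintype α] (G : SimpleGraph α)
    (hG : IsRamseyFor G 3)
    (c : α → α → Bool) (hc : ∀ u v, c u v = c v u)
    (hno : ¬ ∃ b S T, Disjoint S T ∧ IsMonoClique G c b 3 S ∧ IsMonoClique G c b 2 T) :
    ∃ VR VB : Finset α, Disjoint VR VB ∧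
      IsMonoClique G c true 3 VR ∧ IsMonoClique G c false 3 VB := by
  classical
  by_contra hdisj
  have mono := isMonoClique_three_iff G c hc
  obtain ⟨b, S, hS⟩ := hG c hc
  obtain ⟨x, y, z, hxyz, -⟩ := (mono b S).mp hS
  have meet : ∀ b, ∀ x y z u v w, IsTriangle (fun u v => G.Adj u v ∧ c u v = b) x y z →
      IsTriangle (fun u v => G.Adj u v ∧ c u v = !b) u v w →
      (u = x ∨ u = y ∨ u = z) ∨ (v = x ∨ v = y ∨ v = z) ∨ (w = x ∨ w = y ∨ w = z) := by
    intro b x y z u v w hx hu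
    by_contra hmeet
    have hd : Disjoint ({x, y, z} : Finset α) {u, v, w} := by
      rw [Finset.disjoint_left]
      simp only [Finset.mem_insert, Finset.mem_singleton]
      grind
    have h1 := (mono b {x, y, z}).mpr ⟨x, y, z, hx, by simp⟩
    have h2 := (mono (!b) {u, v, w}).mpr ⟨u, v, w, hu, by simp⟩
    cases b
    · exact hdisj ⟨_, _, hd.symm, h2, h1⟩
    · exact hdisj ⟨_, _, hd, h1, h2⟩
  have split : IsIntersectingSplit G (fun u v => G.Adj u v ∧ c u v = b)
      (fun u v => G.Adj u v ∧ c u v = !b) :=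
    { adj_iff := fun u v => by cases b <;> cases c u v <;> simp
      not_both := fun u v => by cases b <;> simp +contextual
      symm_left := fun u v huv => ⟨huv.1.symm, hc u v ▸ huv.2⟩
      symm_right := fun u v huv => ⟨huv.1.symm, hc u v ▸ huv.2⟩
      edge_left := IsTriangle.meets_edge_of_no_pair hc hno b
      edge_right := IsTriangle.meets_edge_of_no_pair hc hno (!b)
      triangle_meet := meet b }
  exact split.not_isRamseyFor hxyz hG
end

section
/- For every integer n ≥ 4 and every finite simple graph G, if G is Ramsey for K_n then G is Ramsey for K_n + K_{n-1}. -/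
open Finset

lemma IsMonoClique.subset {V : Type*} {G : SimpleGraph V} {c : V → V → Bool} {b : Bool} {m : ℕ}
    {S T : Finset V} (h : IsMonoClique G c b m S) (hT : T ⊆ S) : IsMonoClique G c b T.card T :=
  ⟨rfl, fun x hx y hy => h.2.1 x (hT hx) y (hT hy), fun x hx y hy => h.2.2 x (hT hx) y (hT hy)⟩

/-- A monochromatic clique inside a set without monochromatic `K_k` has fewer than `k` vertices. -/
lemma IsMonoClique.card_lt {V : Type*} {G : SimpleGraph V} {c : V → V → Bool} {b : Bool} {m k : ℕ}
    {Q : Finset V} {X : Set V} (h : IsMonoClique G c b m Q) (hQ : ∀ x ∈ Q, x ∈ X)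
    (hX : ∀ P, IsMonoClique G c b k P → ¬ ∀ x ∈ P, x ∈ X) : m < k := by
  by_contra! hk
  obtain ⟨P, hPQ, hP⟩ := Finset.exists_subset_card_eq (hk.trans h.1.ge)
  exact hX P (hP ▸ h.subset hPQ) fun x hx => hQ x (hPQ hx)

lemma IsMonoClique.insert {V : Type*} [DecidableEq V] {G : SimpleGraph V} {c : V → V → Bool}
    (hc : ∀ x y, c x y = c y x) {b : Bool} {m : ℕ} {Q : Finset V} (h : IsMonoClique G c b m Q)
    {v : V} (hv : v ∉ Q) (hadj : ∀ x ∈ Q, G.Adj v x) (hcol : ∀ x ∈ Q, c v x = b) :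
    IsMonoClique G c b (m + 1) (insert v Q) := by
  refine ⟨by rw [Finset.card_insert_of_notMem hv, h.1], ?_, ?_⟩
  · intro x hx y hy hxy
    rcases Finset.mem_insert.1 hx with rfl | hxQ <;> rcases Finset.mem_insert.1 hy with rfl | hyQ
    · exact absurd rfl hxy
    · exact hadj y hyQ
    · exact (hadj x hxQ).symm
    · exact h.2.1 x hxQ y hyQ hxy
  · intro x hx y hy hxy
    rcases Finset.mem_insert.1 hx with rfl | hxQ <;> rcases Finset.mem_insert.1 hy with rfl | hyQ
    · exact absurd rfl hxy
    · exact hcol y hyQ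
    · rw [hc]; exact hcol x hxQ
    · exact h.2.2 x hxQ y hyQ hxy

/-- Two cliques of different colours share at most one vertex. -/
lemma IsMonoClique.card_inter_le_one {V : Type*} [DecidableEq V] {G : SimpleGraph V}
    {c : V → V → Bool} {a : Bool} {m k : ℕ} {S B : Finset V} (hS : IsMonoClique G c a m S)
    (hB : IsMonoClique G c (!a) k B) : (S ∩ B).card ≤ 1 := by
  rw [Finset.card_le_one]
  intro x hx y hy
  rw [Finset.mem_inter] at hx hy
  by_contra hxy
  have h1 := hS.2.2 x hx.1 y hy.1 hxy
  have h2 := hB.2.2 x hx.2 y hy.2 hxy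
  simp [h1] at h2

/-- A criterion for a colouring `c` to have no `K_n` in colour `b`: inside `S` only the edge
`s₁s₂` may have colour `b`, inside `B` the edge `b₁b₂` does not, and outside `S ∪ B` the cliques of
colour `b` are small. -/
lemma not_isMonoClique_of_parts {V : Type*} [DecidableEq V] {G : SimpleGraph V}
    {c : V → V → Bool} {b : Bool} {n : ℕ} (hn : 3 ≤ n) {S B : Finset V} {s₁ s₂ b₁ b₂ : V}
    (hSS : ∀ x ∈ S, ∀ y ∈ S, x ≠ y → c x y = b → (x = s₁ ∧ y = s₂) ∨ (x = s₂ ∧ y = s₁))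
    (hBB : ∀ A ⊆ B, (∀ x ∈ A, ∀ y ∈ A, x ≠ y → c x y = b) → ¬ (b₁ ∈ A ∧ b₂ ∈ A))
    (hBcard : ∀ A ⊆ B, ¬ (b₁ ∈ A ∧ b₂ ∈ A) → A.card < n)
    (hsB : ∀ y ∈ B, ¬ (c s₁ y = b ∧ c s₂ y = b))
    (hSB : ∀ s ∈ S, ∀ A ⊆ B \ {b₁, b₂}, (∀ y ∈ A, c s y = b) → A.card + 3 ≤ n)
    (hBO : ∀ y ∈ B, ∀ o, o ∉ S → o ∉ B → c y o = b → y = b₁ ∨ y = b₂)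
    (hBQ : ∀ y ∈ B, ∀ m Q, IsMonoClique G c b m Q → (∀ o ∈ Q, o ∉ S ∧ o ∉ B) → Q.Nonempty →
      (∀ o ∈ Q, c y o = b) → m + 3 ≤ n)
    (hO : ∀ m Q, IsMonoClique G c b m Q → (∀ o ∈ Q, o ∉ S ∧ o ∉ B) → m + 2 ≤ n)
    (hSO : ∀ m Q, IsMonoClique G c b m Q → (∀ o ∈ Q, o ∉ S ∧ o ∉ B) →
      (∀ o ∈ Q, (G.Adj s₁ o ∧ c s₁ o = b) ∧ (G.Adj s₂ o ∧ c s₂ o = b)) → m + 3 ≤ n)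
    (K : Finset V) : ¬ IsMonoClique G c b n K := by
  intro hK
  have hcol := hK.2.2
  set KS := K.filter (· ∈ S) with hKS
  set KB := K.filter (fun x => x ∉ S ∧ x ∈ B) with hKB
  set KO := K.filter (fun x => x ∉ S ∧ x ∉ B) with hKO
  have hsum : KS.card + KB.card + KO.card = n := by
    rw [← hK.1, ← Finset.card_filter_add_card_filter_not (s := K) (· ∈ S),
      ← Finset.card_filter_add_card_filter_not (s := K.filter (· ∉ S)) (· ∈ B),
      Finset.filter_filter, Finset.filter_filter, add_assoc]
  have hKBB : KB ⊆ B := fun x hx => by simp [hKB] at hx; exact hx.2.2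
  have hKOm : IsMonoClique G c b KO.card KO := hK.subset (Finset.filter_subset _ _)
  have hKOo : ∀ o ∈ KO, o ∉ S ∧ o ∉ B := fun o ho => (Finset.mem_filter.1 ho).2
  have hO' := hO _ _ hKOm hKOo
  have hKB12 : ¬ (b₁ ∈ KB ∧ b₂ ∈ KB) := by
    refine hBB KB hKBB fun x hx y hy => hcol x ?_ y ?_
    · exact (Finset.mem_filter.1 hx).1
    · exact (Finset.mem_filter.1 hy).1
  by_cases h12 : s₁ ∈ KS ∧ s₂ ∈ KS ∧ s₁ ≠ s₂
  · obtain ⟨h1, h2, hne⟩ := h12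
    rw [hKS, Finset.mem_filter] at h1 h2
    have hKS2 : KS.card ≤ 2 := by
      refine (Finset.card_le_card (t := {s₁, s₂}) fun x hx => ?_).trans Finset.card_le_two
      rw [hKS, Finset.mem_filter] at hx
      by_cases hx1 : x = s₁
      · simp [hx1]
      · rcases hSS x hx.2 s₁ h1.2 hx1 (hcol x hx.1 s₁ h1.1 hx1) with h | h <;> simp [h.1]
    have hKB0 : KB = ∅ := by
      rw [Finset.eq_empty_iff_forall_notMem]
      intro y hy
      rw [hKB, Finset.mem_filter] at hy
      exact hsB y hy.2.2 ⟨hcol _ h1.1 _ hy.1 fun h => hy.2.1 (h ▸ h1.2),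
        hcol _ h2.1 _ hy.1 fun h => hy.2.1 (h ▸ h2.2)⟩
    have := hSO _ _ hKOm hKOo fun o ho => by
      rw [hKO, Finset.mem_filter] at ho
      have e1 : s₁ ≠ o := fun h => ho.2.1 (h ▸ h1.2)
      have e2 : s₂ ≠ o := fun h => ho.2.1 (h ▸ h2.2)
      exact ⟨⟨hK.2.1 _ h1.1 _ ho.1 e1, hcol _ h1.1 _ ho.1 e1⟩,
        ⟨hK.2.1 _ h2.1 _ ho.1 e2, hcol _ h2.1 _ ho.1 e2⟩⟩
    rw [hKB0, Finset.card_empty] at hsum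
    omega
  · have hKS1 : KS.card ≤ 1 := by
      rw [Finset.card_le_one]
      intro x hx y hy
      by_contra hxy
      have hx' := Finset.mem_filter.1 hx
      have hy' := Finset.mem_filter.1 hy
      rcases hSS x hx'.2 y hy'.2 hxy (hcol x hx'.1 y hy'.1 hxy) with ⟨rfl, rfl⟩ | ⟨rfl, rfl⟩
      · exact h12 ⟨hx, hy, hxy⟩
      · exact h12 ⟨hy, hx, Ne.symm hxy⟩
    rcases KO.eq_empty_or_nonempty with hKO0 | hKO0
    · rw [hKO0, Finset.card_empty] at hsum
      rcases KS.eq_empty_or_nonempty with hKS0 | ⟨s, hs⟩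
      · rw [hKS0, Finset.card_empty] at hsum
        have := hBcard KB hKBB hKB12
        omega
      · rw [hKS, Finset.mem_filter] at hs
        have h3 := hSB s hs.2 (KB \ {b₁, b₂}) (Finset.sdiff_subset_sdiff hKBB subset_rfl)
          fun y hy => by
            rw [Finset.mem_sdiff, hKB, Finset.mem_filter] at hy
            exact hcol s hs.1 y hy.1.1 fun h => hy.1.2.1 (h ▸ hs.2)
        have h4 : (KB ∩ {b₁, b₂}).card ≤ 1 := by
          rw [Finset.card_le_one]
          intro x hx y hy
          simp only [Finset.mem_inter, Finset.mem_insert, Finset.mem_singleton] at hx hy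
          grind
        have := Finset.card_sdiff_add_card_inter KB {b₁, b₂}
        omega
    · have hKBsub : ∀ y ∈ KB, y = b₁ ∨ y = b₂ := by
        intro y hy
        obtain ⟨o, ho⟩ := hKO0
        rw [hKB, Finset.mem_filter] at hy
        rw [hKO, Finset.mem_filter] at ho
        exact hBO y hy.2.2 o ho.2.1 ho.2.2 (hcol y hy.1 o ho.1 fun h => ho.2.2 (h ▸ hy.2.2))
      have hKB1 : KB.card ≤ 1 := by
        rw [Finset.card_le_one]
        intro x hx y hy
        have := hKBsub x hx
        have := hKBsub y hy
        grind
      rcases KB.eq_empty_or_nonempty with hKB0 | ⟨y, hy⟩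
      · rw [hKB0, Finset.card_empty] at hsum
        omega
      · rw [hKB, Finset.mem_filter] at hy
        have := hBQ y hy.2.2 _ _ hKOm hKOo hKO0 fun o ho => by
          rw [hKO, Finset.mem_filter] at ho
          exact hcol y hy.1 o ho.1 fun h => ho.2.2 (h ▸ hy.2.2)
        omega

/-- The recolouring used below: inside `S` only `s₁s₂` has colour `a`, inside `B` only `b₁b₂` has
colour `!a`, edges leaving `S ∪ B` from `S` have colour `a` except from `sᵢ` to `Xᵢ`, those from `B`
have colour `!a` except from `bᵢ` to `Yᵢ`, edges between `S` and `B` follow `f`, and the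
remaining edges keep their colour. -/
lemma exists_recolouring {V : Type*} (c : V → V → Bool) (hc : ∀ x y, c x y = c y x) (a : Bool)
    {S B : Finset V} (hSB : Disjoint S B) (s₁ s₂ b₁ b₂ : V) (X₁ X₂ Y₁ Y₂ : Set V) (f : V → Bool) :
    ∃ d : V → V → Bool, (∀ x y, d x y = d y x) ∧
      (∀ x ∈ S, ∀ y ∈ S, d x y = a ↔ (x = s₁ ∧ y = s₂) ∨ (x = s₂ ∧ y = s₁)) ∧
      (∀ x ∈ B, ∀ y ∈ B, d x y = !a ↔ (x = b₁ ∧ y = b₂) ∨ (x = b₂ ∧ y = b₁)) ∧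
      (∀ x ∈ S, ∀ y ∈ B, d x y = a ↔ f x ≠ f y) ∧
      (∀ x ∈ S, ∀ o, o ∉ S → o ∉ B → (d x o = !a ↔ (x = s₁ ∧ o ∈ X₁) ∨ (x = s₂ ∧ o ∈ X₂))) ∧
      (∀ x ∈ B, ∀ o, o ∉ S → o ∉ B → (d x o = a ↔ (x = b₁ ∧ o ∈ Y₁) ∨ (x = b₂ ∧ o ∈ Y₂))) ∧
      (∀ x y, x ∉ S → x ∉ B → y ∉ S → y ∉ B → d x y = c x y) := by
  classical
  rw [Finset.disjoint_left] at hSB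
  let r : V → V → Bool := fun x y =>
    if x ∈ S then
      if y ∈ S then if (x = s₁ ∧ y = s₂) ∨ (x = s₂ ∧ y = s₁) then a else !a
      else if y ∈ B then if f x = f y then !a else a
      else if (x = s₁ ∧ y ∈ X₁) ∨ (x = s₂ ∧ y ∈ X₂) then !a else a
    else if y ∈ B then if (x = b₁ ∧ y = b₂) ∨ (x = b₂ ∧ y = b₁) then !a else a
    else if (x = b₁ ∧ y ∈ Y₁) ∨ (x = b₂ ∧ y ∈ Y₂) then a else !a
  refine ⟨fun x y => if x ∈ S then r x y else if y ∈ S then r y x else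
    if x ∈ B then r x y else if y ∈ B then r y x else c x y, ?_, ?_, ?_, ?_, ?_, ?_, ?_⟩
  · intro x y
    simp only [r]
    grind
  · intro x hx y hy
    simp only [r]
    grind
  · intro x hx y hy
    simp only [r]
    grind
  · intro x hx y hy
    simp only [r]
    grind
  · intro x hx o ho ho'
    simp only [r]
    grind
  · intro x hx o ho ho'
    simp only [r]
    grind
  · intro x y h1 h2 h3 h4
    simp [h1, h2, h3, h4]

lemma exists_splitting {V : Type*} [DecidableEq V] {n : ℕ} (hn : 4 ≤ n) {B : Finset V}
    (hB : B.card ≤ n) {b₁ b₂ : V} (h₁ : b₁ ∈ B) (h₂ : b₂ ∈ B) (h : b₁ ≠ b₂) :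
    ∃ f : V → Bool, f b₁ ≠ f b₂ ∧
      ∀ A ⊆ B \ {b₁, b₂}, ∀ t, (∀ y ∈ A, f y = t) → A.card + 3 ≤ n := by
  have hcard : (B \ {b₁, b₂}).card + 2 ≤ n := by
    have := Finset.card_sdiff_add_card_eq_card (s := {b₁, b₂}) (t := B) (by grind)
    rw [Finset.card_pair h] at this
    omega
  by_cases hs : (B \ {b₁, b₂}).card + 3 ≤ n
  · exact ⟨fun x => decide (x = b₁), by simp [Ne.symm h], fun A hA _ _ =>
      (Nat.add_le_add_right (Finset.card_le_card hA) 3).trans hs⟩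
  · obtain ⟨b₃, h₃, b₄, h₄, h34⟩ := Finset.one_lt_card.1 (show 1 < (B \ {b₁, b₂}).card by omega)
    refine ⟨fun x => decide (x = b₁ ∨ x = b₃), by grind, fun A hA t ht => ?_⟩
    have hlt : A.card < (B \ {b₁, b₂}).card := by
      refine Finset.card_lt_card ⟨hA, fun hsub => ?_⟩
      have e₃ := ht _ (hsub h₃)
      have e₄ := ht _ (hsub h₄)
      grind
    omega

/-- If any two of `x, y, z` extend to `K_n` of colour `a` by a clique outside prescribed sets
`X₁, X₂` without `K_k` of colour `!a`, then there is a monochromatic `K_n + K_{n-1}`. -/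
lemma exists_pair_of_extensions {V : Type*} {G : SimpleGraph V}
    {c : V → V → Bool} (hc : ∀ x y, c x y = c y x) {a : Bool} {n k : ℕ} (hn : 2 ≤ n) (hk : 2 ≤ k)
    {A : Finset V} (hA : 3 ≤ A.card) {m : ℕ} (hAm : IsMonoClique G c a m A) {O : Set V}
    (hAO : ∀ x ∈ A, x ∉ O)
    (hgood : ∀ v ∈ A, ∀ P, IsMonoClique G c (!a) k P →
      ¬ ∀ x ∈ P, x ∈ {o | o ∈ O ∧ G.Adj v o ∧ c v o = !a})
    (hext : ∀ s₁ ∈ A, ∀ s₂ ∈ A, s₁ ≠ s₂ → ∀ X₁ X₂ : Set V,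
      (∀ P, IsMonoClique G c (!a) k P → ¬ ∀ x ∈ P, x ∈ X₁) →
      (∀ P, IsMonoClique G c (!a) k P → ¬ ∀ x ∈ P, x ∈ X₂) →
      ∃ Q, IsMonoClique G c a (n - 2) Q ∧
        ∀ o ∈ Q, o ∈ O ∧ G.Adj s₁ o ∧ G.Adj s₂ o ∧ o ∉ X₁ ∧ o ∉ X₂) :
    ∃ b S T, Disjoint S T ∧ IsMonoClique G c b n S ∧ IsMonoClique G c b (n - 1) T := by
  classical
  obtain ⟨x, y, z, hx, hy, hz, hxy, hxz, hyz⟩ := Finset.two_lt_card_iff.1 hA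
  have hred : ∀ v o, o ∈ O → G.Adj v o → o ∉ {o | o ∈ O ∧ G.Adj v o ∧ c v o = !a} → c v o = a := by
    intro v o h1 h2 h3
    by_contra h
    exact h3 ⟨h1, h2, by simpa [Bool.eq_not] using h⟩
  obtain ⟨Q, hQ, hQO⟩ := hext x hx y hy hxy _ _ (hgood x hx) (hgood y hy)
  obtain ⟨P, hP, hPO⟩ := hext x hx z hz hxz (Q : Set V) _ (fun R hR hRQ => by
    obtain ⟨u, hu, v, hv, huv⟩ := Finset.one_lt_card.1 (show 1 < R.card by rw [hR.1]; omega)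
    have e₁ := hR.2.2 u hu v hv huv
    have e₂ := hQ.2.2 u (hRQ u hu) v (hRQ v hv) huv
    simp [e₂] at e₁) (hgood z hz)
  have hyQ : IsMonoClique G c a (n - 2 + 1) (insert y Q) :=
    hQ.insert hc (fun h => hAO y hy (hQO y h).1) (fun o ho => (hQO o ho).2.2.1) fun o ho =>
      hred y o (hQO o ho).1 (hQO o ho).2.2.1 (hQO o ho).2.2.2.2
  have hxyQ : IsMonoClique G c a (n - 2 + 1 + 1) (insert x (insert y Q)) := by
    refine hyQ.insert hc ?_ ?_ ?_
    · rw [Finset.mem_insert, not_or]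
      exact ⟨hxy, fun h => hAO x hx (hQO x h).1⟩
    · intro o ho
      rcases Finset.mem_insert.1 ho with rfl | ho
      · exact hAm.2.1 x hx _ hy hxy
      · exact (hQO o ho).2.1
    · intro o ho
      rcases Finset.mem_insert.1 ho with rfl | ho
      · exact hAm.2.2 x hx _ hy hxy
      · exact hred x o (hQO o ho).1 (hQO o ho).2.1 (hQO o ho).2.2.2.1
  have hzP : IsMonoClique G c a (n - 2 + 1) (insert z P) :=
    hP.insert hc (fun h => hAO z hz (hPO z h).1) (fun o ho => (hPO o ho).2.2.1) fun o ho =>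
      hred z o (hPO o ho).1 (hPO o ho).2.2.1 (hPO o ho).2.2.2.2
  rw [show n - 2 + 1 + 1 = n by omega] at hxyQ
  rw [show n - 2 + 1 = n - 1 by omega] at hzP
  refine ⟨a, _, _, ?_, hxyQ, hzP⟩
  rw [Finset.disjoint_left]
  intro o ho ho'
  simp only [Finset.mem_insert] at ho ho'
  have hPQ : ∀ u ∈ P, u ∉ Q := fun u hu h => (hPO u hu).2.2.2.1 h
  have hP' : ∀ u ∈ P, u ∉ A := fun u hu h => hAO u h (hPO u hu).1
  have hQ' : ∀ u ∈ Q, u ∉ A := fun u hu h => hAO u h (hQO u hu).1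
  grind

/-- If only one colour class contains `K_n`, a clique `S` of that colour satisfies the extension
property. -/
lemma exists_extension_of_one_colour {V : Type*} {G : SimpleGraph V} {n : ℕ} (hn : 3 ≤ n)
    (hG : IsRamseyFor G n) {c : V → V → Bool} (hc : ∀ x y, c x y = c y x) {a : Bool}
    {S : Finset V} (hS : S.card ≤ n) (hno : ∀ B, ¬ IsMonoClique G c (!a) n B)
    (hO : ∀ P, IsMonoClique G c a (n - 1) P → ¬ ∀ x ∈ P, x ∉ S)
    {s₁ s₂ : V} (h₁ : s₁ ∈ S) (h₂ : s₂ ∈ S) (h12 : s₁ ≠ s₂) {X₁ X₂ : Set V}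
    (hX₁ : ∀ P, IsMonoClique G c (!a) (n - 1) P → ¬ ∀ x ∈ P, x ∈ X₁)
    (hX₂ : ∀ P, IsMonoClique G c (!a) (n - 1) P → ¬ ∀ x ∈ P, x ∈ X₂) :
    ∃ Q, IsMonoClique G c a (n - 2) Q ∧
      ∀ o ∈ Q, o ∈ {x | x ∉ S} ∧ G.Adj s₁ o ∧ G.Adj s₂ o ∧ o ∉ X₁ ∧ o ∉ X₂ := by
  classical
  by_contra hQ
  push Not at hQ
  obtain ⟨d, hd, hdS, -, -, hdSO, -, hdO⟩ := exists_recolouring c hc a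
    (Finset.disjoint_empty_right S) s₁ s₂ s₁ s₂ X₁ X₂ ∅ ∅ (fun _ => true)
  have hdO' : ∀ {b m Q}, IsMonoClique G d b m Q → (∀ o ∈ Q, o ∉ S) → IsMonoClique G c b m Q :=
    fun {b m Q} h hQS => ⟨h.1, h.2.1, fun x hx y hy hxy => by
      rw [← hdO x y (hQS x hx) (by simp) (hQS y hy) (by simp)]; exact h.2.2 x hx y hy hxy⟩
  obtain ⟨b, K, hK⟩ := hG d hd
  rcases Bool.eq_or_eq_not b a with rfl | rfl
  · refine not_isMonoClique_of_parts (S := S) (B := ∅) (s₁ := s₁) (s₂ := s₂) (b₁ := s₁) (b₂ := s₂)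
      hn ?_ ?_ ?_ (by simp) ?_ (by simp) (by simp) ?_ ?_ K hK
    · exact fun x hx y hy _ h => (hdS x hx y hy).1 h
    · intro A hA _ h
      simpa using hA h.1
    · intro A hA _
      rw [Finset.subset_empty.1 hA, Finset.card_empty]
      omega
    · intro s _ A hA _
      rw [Finset.subset_empty.1 (hA.trans Finset.sdiff_subset), Finset.card_empty]
      omega
    · intro m Q hQm hQS
      have := (hdO' hQm fun o ho => (hQS o ho).1).card_lt (X := {x | x ∉ S})
        (fun o ho => (hQS o ho).1) hO
      omega
    · intro m Q hQm hQS hQs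
      have := (hdO' hQm fun o ho => (hQS o ho).1).card_lt (k := n - 2)
        (X := {o | o ∉ S ∧ G.Adj s₁ o ∧ G.Adj s₂ o ∧ o ∉ X₁ ∧ o ∉ X₂}) (fun o ho => by
          have e₁ := hdSO s₁ h₁ o (hQS o ho).1 (by simp)
          have e₂ := hdSO s₂ h₂ o (hQS o ho).1 (by simp)
          rw [(hQs o ho).1.2] at e₁
          rw [(hQs o ho).2.2] at e₂
          refine ⟨(hQS o ho).1, (hQs o ho).1.1, (hQs o ho).2.1, ?_, ?_⟩
          · intro h; simpa using e₁.2 (Or.inl ⟨rfl, h⟩)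
          · intro h; simpa using e₂.2 (Or.inr ⟨rfl, h⟩)) fun P hP hPX => by
          obtain ⟨o, ho, h⟩ := hQ P hP
          obtain ⟨p₁, p₂, p₃, p₄, p₅⟩ := hPX o ho
          exact p₅ (h p₁ p₂ p₃ p₄)
      omega
  · have hs : ¬ (s₁ ∈ K ∧ s₂ ∈ K) := fun h => by
      have := hK.2.2 s₁ h.1 s₂ h.2 h12
      rw [(hdS s₁ h₁ s₂ h₂).2 (Or.inl ⟨rfl, rfl⟩)] at this
      simp at this
    by_cases hKS : K ⊆ S
    · have := Finset.eq_of_subset_of_card_le hKS (by rw [hK.1]; exact hS)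
      exact hs ⟨this ▸ h₁, this ▸ h₂⟩
    · obtain ⟨o, hoK, hoS⟩ := Finset.not_subset.1 hKS
      have hsub : ∀ x ∈ K, x ∈ S → x = s₁ ∨ x = s₂ := fun x hx hxS => by
        have := (hdSO x hxS o hoS (by simp)).1 (hK.2.2 x hx o hoK fun h => hoS (h ▸ hxS))
        tauto
      have herase : ∀ s ∈ S, s ∈ K → (∀ x ∈ K, x ∈ S → x = s) → ∀ X : Set V,
          (∀ o ∉ S, d s o = (!a) → o ∈ X) →
          (∀ P, IsMonoClique G c (!a) (n - 1) P → ¬ ∀ x ∈ P, x ∈ X) → False := by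
        intro s hsS hsK hK1 X hdX hX
        have hOS : ∀ o ∈ K.erase s, o ∉ S := fun o ho h =>
          (Finset.mem_erase.1 ho).1 (hK1 o (Finset.mem_erase.1 ho).2 h)
        have := (hdO' (hK.subset (Finset.erase_subset s K)) hOS).card_lt (X := X)
          (fun o ho => hdX o (hOS o ho) (hK.2.2 s hsK o (Finset.mem_erase.1 ho).2
            (Finset.mem_erase.1 ho).1.symm)) hX
        rw [Finset.card_erase_of_mem hsK, hK.1] at this
        omega
      by_cases hk₁ : s₁ ∈ K
      · refine herase s₁ h₁ hk₁ (fun x hx hxS => ?_) X₁ (fun o ho h => ?_) hX₁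
        · rcases hsub x hx hxS with rfl | rfl
          · rfl
          · exact absurd ⟨hk₁, hx⟩ hs
        · have := (hdSO s₁ h₁ o ho (by simp)).1 h
          tauto
      · by_cases hk₂ : s₂ ∈ K
        · refine herase s₂ h₂ hk₂ (fun x hx hxS => ?_) X₂ (fun o ho h => ?_) hX₂
          · rcases hsub x hx hxS with rfl | rfl
            · exact absurd hx hk₁
            · rfl
          · have := (hdSO s₂ h₂ o ho (by simp)).1 h
            have := h12.symm
            tauto
        · refine hno K (hdO' hK fun x hx hxS => ?_)
          rcases hsub x hx hxS with rfl | rfl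
          · exact hk₁ hx
          · exact hk₂ hx

/-- If the vertices outside `S ∪ B` span no monochromatic `K_{n-1}`, the extension property holds
for a pair in `S` or for a pair in `B`. -/
lemma exists_extension_of_two_colours {V : Type*} {G : SimpleGraph V} {n : ℕ} (hn : 4 ≤ n)
    (hG : IsRamseyFor G n) {c : V → V → Bool} (hc : ∀ x y, c x y = c y x) {a : Bool}
    {S B : Finset V} (hSB : Disjoint S B) (hS : S.card ≤ n) (hB : B.card ≤ n)
    (hO : ∀ b P, IsMonoClique G c b (n - 1) P → ¬ ∀ x ∈ P, x ∈ {x | x ∉ S ∧ x ∉ B})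
    {s₁ s₂ b₁ b₂ : V} (hs₁ : s₁ ∈ S) (hs₂ : s₂ ∈ S) (hs : s₁ ≠ s₂)
    (hb₁ : b₁ ∈ B) (hb₂ : b₂ ∈ B) (hb : b₁ ≠ b₂) {X₁ X₂ Y₁ Y₂ : Set V}
    (hX₁ : ∀ P, IsMonoClique G c (!a) (n - 2) P → ¬ ∀ x ∈ P, x ∈ X₁)
    (hX₂ : ∀ P, IsMonoClique G c (!a) (n - 2) P → ¬ ∀ x ∈ P, x ∈ X₂)
    (hY₁ : ∀ P, IsMonoClique G c a (n - 2) P → ¬ ∀ x ∈ P, x ∈ Y₁)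
    (hY₂ : ∀ P, IsMonoClique G c a (n - 2) P → ¬ ∀ x ∈ P, x ∈ Y₂) :
    (∃ Q, IsMonoClique G c a (n - 2) Q ∧ ∀ o ∈ Q, o ∈ {x | x ∉ S ∧ x ∉ B} ∧
      G.Adj s₁ o ∧ G.Adj s₂ o ∧ o ∉ X₁ ∧ o ∉ X₂) ∨
    (∃ Q, IsMonoClique G c (!a) (n - 2) Q ∧ ∀ o ∈ Q, o ∈ {x | x ∉ S ∧ x ∉ B} ∧
      G.Adj b₁ o ∧ G.Adj b₂ o ∧ o ∉ Y₁ ∧ o ∉ Y₂) := by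
  classical
  by_contra! hQ
  obtain ⟨hQa, hQb⟩ := hQ
  obtain ⟨f₁, hf₁, hf₁'⟩ := exists_splitting hn hS hs₁ hs₂ hs
  obtain ⟨f₂, hf₂, hf₂'⟩ := exists_splitting hn hB hb₁ hb₂ hb
  have hSB' := Finset.disjoint_left.1 hSB
  have hBS' := Finset.disjoint_right.1 hSB
  obtain ⟨d, hd, hdS, hdB, hdSB, hdSO, hdBO, hdO⟩ := exists_recolouring c hc a hSB
    s₁ s₂ b₁ b₂ X₁ X₂ Y₁ Y₂ (fun x => if x ∈ S then f₁ x else f₂ x)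
  have hdSB₁ : ∀ x ∈ S, ∀ y ∈ B, d x y = a → f₂ y = !f₁ x := fun x hx y hy h => by
    have := (hdSB x hx y hy).1 h
    simp only [hx, hBS' hy, if_true, if_false] at this
    exact Bool.eq_not.2 this.symm
  have hdSB₂ : ∀ x ∈ S, ∀ y ∈ B, d y x = (!a) → f₁ x = f₂ y := fun x hx y hy h => by
    have := (hdSB x hx y hy).not.1 (by rw [hd, h]; simp)
    simpa only [hx, hBS' hy, if_true, if_false, not_not] using this
  have hdO' : ∀ {b m Q}, IsMonoClique G d b m Q → (∀ o ∈ Q, o ∉ S ∧ o ∉ B) →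
      IsMonoClique G c b m Q :=
    fun {b m Q} h hQ => ⟨h.1, h.2.1, fun x hx y hy hxy => by
      rw [← hdO x y (hQ x hx).1 (hQ x hx).2 (hQ y hy).1 (hQ y hy).2]; exact h.2.2 x hx y hy hxy⟩
  have hcard : ∀ (B : Finset V) (b₁ b₂ : V), B.card ≤ n → b₁ ∈ B → b₂ ∈ B →
      ∀ A ⊆ B, ¬ (b₁ ∈ A ∧ b₂ ∈ A) → A.card < n := fun B b₁ b₂ hB h₁ h₂ A hA h =>
    (Finset.card_lt_card ⟨hA, fun hBA => h ⟨hBA h₁, hBA h₂⟩⟩).trans_le hB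
  obtain ⟨b, K, hK⟩ := hG d hd
  rcases Bool.eq_or_eq_not b a with rfl | rfl
  · refine not_isMonoClique_of_parts (S := S) (B := B) (s₁ := s₁) (s₂ := s₂) (b₁ := b₁) (b₂ := b₂)
      (by omega) ?_ ?_ (hcard B b₁ b₂ hB hb₁ hb₂) ?_ ?_ ?_ ?_ ?_ ?_ K hK
    · exact fun x hx y hy _ h => (hdS x hx y hy).1 h
    · intro A _ h hA
      have := h b₁ hA.1 b₂ hA.2 hb
      rw [(hdB b₁ hb₁ b₂ hb₂).2 (Or.inl ⟨rfl, rfl⟩)] at this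
      simp at this
    · intro y hy h
      have e₁ := hdSB₁ s₁ hs₁ y hy h.1
      have e₂ := hdSB₁ s₂ hs₂ y hy h.2
      exact hf₁ (Bool.not_inj (e₁.symm.trans e₂))
    · exact fun s hsS A hA h => hf₂' A hA (!f₁ s) fun y hy =>
        hdSB₁ s hsS y (Finset.mem_sdiff.1 (hA hy)).1 (h y hy)
    · intro y hy o ho ho' h
      have := (hdBO y hy o ho ho').1 h
      tauto
    · intro y hy m Q hQm hQO ⟨o, ho⟩ h
      have hall : ∀ o ∈ Q, _ := fun o ho => (hdBO y hy o (hQO o ho).1 (hQO o ho).2).1 (h o ho)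
      rcases hall o ho with ⟨rfl, -⟩ | ⟨rfl, -⟩
      · have := (hdO' hQm hQO).card_lt (fun o ho => by have := hall o ho; tauto) hY₁
        omega
      · have := (hdO' hQm hQO).card_lt (fun o ho => by
          have := hall o ho; have := hb.symm; tauto) hY₂
        omega
    · intro m Q hQm hQO
      have := (hdO' hQm hQO).card_lt hQO (hO _)
      omega
    · intro m Q hQm hQO h
      have := (hdO' hQm hQO).card_lt (k := n - 2) (X := {o | o ∈ {x | x ∉ S ∧ x ∉ B} ∧
        G.Adj s₁ o ∧ G.Adj s₂ o ∧ o ∉ X₁ ∧ o ∉ X₂}) (fun o ho => by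
          have e₁ := hdSO s₁ hs₁ o (hQO o ho).1 (hQO o ho).2
          have e₂ := hdSO s₂ hs₂ o (hQO o ho).1 (hQO o ho).2
          rw [(h o ho).1.2] at e₁
          rw [(h o ho).2.2] at e₂
          refine ⟨hQO o ho, (h o ho).1.1, (h o ho).2.1, ?_, ?_⟩
          · intro h; simpa using e₁.2 (Or.inl ⟨rfl, h⟩)
          · intro h; simpa using e₂.2 (Or.inr ⟨rfl, h⟩)) fun P hP hPX => by
          obtain ⟨o, ho, h⟩ := hQa P hP
          obtain ⟨p₁, p₂, p₃, p₄, p₅⟩ := hPX o ho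
          exact p₅ (h p₁ p₂ p₃ p₄)
      omega
  · refine not_isMonoClique_of_parts (S := B) (B := S) (s₁ := b₁) (s₂ := b₂) (b₁ := s₁) (b₂ := s₂)
      (by omega) ?_ ?_ (hcard S s₁ s₂ hS hs₁ hs₂) ?_ ?_ ?_ ?_ ?_ ?_ K hK
    · exact fun x hx y hy _ h => (hdB x hx y hy).1 h
    · intro A _ h hA
      have := h s₁ hA.1 s₂ hA.2 hs
      rw [(hdS s₁ hs₁ s₂ hs₂).2 (Or.inl ⟨rfl, rfl⟩)] at this
      simp at this
    · intro y hy h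
      have e₁ := hdSB₂ y hy b₁ hb₁ h.1
      have e₂ := hdSB₂ y hy b₂ hb₂ h.2
      exact hf₂ (e₁.symm.trans e₂)
    · exact fun s hsB A hA h => hf₁' A hA (f₂ s) fun y hy =>
        hdSB₂ y (Finset.mem_sdiff.1 (hA hy)).1 s hsB (h y hy)
    · intro y hy o ho ho' h
      have := (hdSO y hy o ho' ho).1 h
      tauto
    · intro y hy m Q hQm hQO ⟨o, ho⟩ h
      have hQO' : ∀ o ∈ Q, o ∉ S ∧ o ∉ B := fun o ho => (hQO o ho).symm
      have hall : ∀ o ∈ Q, _ := fun o ho => (hdSO y hy o (hQO o ho).2 (hQO o ho).1).1 (h o ho)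
      rcases hall o ho with ⟨rfl, -⟩ | ⟨rfl, -⟩
      · have := (hdO' hQm hQO').card_lt (fun o ho => by have := hall o ho; tauto) hX₁
        omega
      · have := (hdO' hQm hQO').card_lt (fun o ho => by
          have := hall o ho; have := hs.symm; tauto) hX₂
        omega
    · intro m Q hQm hQO
      have hQO' : ∀ o ∈ Q, o ∉ S ∧ o ∉ B := fun o ho => (hQO o ho).symm
      have := (hdO' hQm hQO').card_lt hQO' (hO _)
      omega
    · intro m Q hQm hQO h
      have hQO' : ∀ o ∈ Q, o ∉ S ∧ o ∉ B := fun o ho => (hQO o ho).symm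
      have := (hdO' hQm hQO').card_lt (k := n - 2) (X := {o | o ∈ {x | x ∉ S ∧ x ∉ B} ∧
        G.Adj b₁ o ∧ G.Adj b₂ o ∧ o ∉ Y₁ ∧ o ∉ Y₂}) (fun o ho => by
          have e₁ := hdBO b₁ hb₁ o (hQO' o ho).1 (hQO' o ho).2
          have e₂ := hdBO b₂ hb₂ o (hQO' o ho).1 (hQO' o ho).2
          rw [(h o ho).1.2] at e₁
          rw [(h o ho).2.2] at e₂
          refine ⟨hQO' o ho, (h o ho).1.1, (h o ho).2.1, ?_, ?_⟩
          · intro h; simpa using e₁.2 (Or.inl ⟨rfl, h⟩)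
          · intro h; simpa using e₂.2 (Or.inr ⟨rfl, h⟩)) fun P hP hPX => by
          obtain ⟨o, ho, h⟩ := hQb P hP
          obtain ⟨p₁, p₂, p₃, p₄, p₅⟩ := hPX o ho
          exact p₅ (h p₁ p₂ p₃ p₄)
      omega

theorem ramsey_Kn_imp_ramsey_Kn_add_Knsub1 (n : ℕ) (hn : 4 ≤ n)
    {V : Type*} [Fintype V] (G : SimpleGraph V)
    (hG : IsRamseyFor G n) : IsRamseyForPair G n (n - 1) := by
  classical
  intro c hc
  by_contra hpair
  have hmeet : ∀ {b S P}, IsMonoClique G c b n S → IsMonoClique G c b (n - 1) P →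
      ¬ ∀ x ∈ P, x ∉ S := fun {b S P} hS hP h =>
    hpair ⟨b, S, P, Finset.disjoint_right.2 fun {x} hx => h x hx, hS, hP⟩
  obtain ⟨a, S, hS⟩ := hG c hc
  by_cases hno : ∀ B, ¬ IsMonoClique G c (!a) n B
  · refine hpair (exists_pair_of_extensions hc (k := n - 1) (O := {x | x ∉ S}) (by omega)
      (by omega) (by rw [hS.1]; omega) hS (fun x hx h => h hx) ?_ ?_)
    · intro v hv P hP hPv
      have := hP.insert hc (v := v) (fun h => (hPv v h).1 hv) (fun o ho => (hPv o ho).2.1)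
        fun o ho => (hPv o ho).2.2
      rw [show n - 1 + 1 = n by omega] at this
      exact hno _ this
    · intro s₁ h₁ s₂ h₂ h12 X₁ X₂ hX₁ hX₂
      exact exists_extension_of_one_colour (by omega) hG hc hS.1.le hno (fun P hP => hmeet hS hP)
        h₁ h₂ h12 hX₁ hX₂
  · push Not at hno
    obtain ⟨B, hB⟩ := hno
    have hint := hS.card_inter_le_one hB
    have hcS : 3 ≤ (S \ B).card := by
      have := Finset.card_sdiff_add_card_inter S B
      have := hS.1
      omega
    have hcB : 3 ≤ (B \ S).card := by
      have := Finset.card_sdiff_add_card_inter B S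
      rw [Finset.inter_comm] at this
      have := hB.1
      omega
    have hmem : ∀ x, x ∈ {x | x ∉ S ∧ x ∉ B \ S} ↔ x ∉ S ∧ x ∉ B := by
      intro x
      simp only [Set.mem_ofPred_eq, Finset.mem_sdiff]
      tauto
    have hgood : ∀ {b v T}, IsMonoClique G c b n T → v ∉ T →
        (∀ x, x ∈ {x | x ∉ S ∧ x ∉ B \ S} → x ∉ T ∧ x ≠ v) → ∀ P, IsMonoClique G c b (n - 2) P →
          ¬ ∀ x ∈ P, x ∈ {o | o ∈ {x | x ∉ S ∧ x ∉ B \ S} ∧ G.Adj v o ∧ c v o = b} := by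
      intro b v T hT hv hOT P hP hPv
      have := hP.insert hc (v := v) (fun h => (hOT v (hPv v h).1).2 rfl)
        (fun o ho => (hPv o ho).2.1) fun o ho => (hPv o ho).2.2
      rw [show n - 2 + 1 = n - 1 by omega] at this
      refine hmeet hT this fun x hx => ?_
      rcases Finset.mem_insert.1 hx with rfl | hx
      · exact hv
      · exact (hOT x (hPv x hx).1).1
    by_cases hext : ∀ s₁ ∈ S \ B, ∀ s₂ ∈ S \ B, s₁ ≠ s₂ → ∀ X₁ X₂ : Set V,
        (∀ P, IsMonoClique G c (!a) (n - 2) P → ¬ ∀ x ∈ P, x ∈ X₁) →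
        (∀ P, IsMonoClique G c (!a) (n - 2) P → ¬ ∀ x ∈ P, x ∈ X₂) →
        ∃ Q, IsMonoClique G c a (n - 2) Q ∧ ∀ o ∈ Q, o ∈ {x | x ∉ S ∧ x ∉ B \ S} ∧
          G.Adj s₁ o ∧ G.Adj s₂ o ∧ o ∉ X₁ ∧ o ∉ X₂
    · refine hpair (exists_pair_of_extensions hc (by omega) (by omega) hcS
        (hS.subset Finset.sdiff_subset) (fun x hx h => h.1 (Finset.mem_sdiff.1 hx).1) ?_ hext)
      intro v hv
      rw [Finset.mem_sdiff] at hv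
      exact hgood hB hv.2 fun x hx => ⟨((hmem x).1 hx).2, fun h => ((hmem x).1 hx).1 (h ▸ hv.1)⟩
    · push Not at hext
      obtain ⟨s₁, hs₁, s₂, hs₂, hs, X₁, X₂, hX₁, hX₂, hQ⟩ := hext
      refine hpair (exists_pair_of_extensions (a := !a) (k := n - 2)
        (O := {x | x ∉ S ∧ x ∉ B \ S}) hc (by omega) (by omega) hcB
        (hB.subset Finset.sdiff_subset) (fun x hx h => h.2 hx) ?_ ?_)
      · intro v hv
        rw [Bool.not_not]
        rw [Finset.mem_sdiff] at hv
        exact hgood hS hv.2 fun x hx => ⟨hx.1, fun h => ((hmem x).1 hx).2 (h ▸ hv.1)⟩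
      · intro b₁ hb₁ b₂ hb₂ hb Y₁ Y₂ hY₁ hY₂
        rw [Bool.not_not] at hY₁ hY₂
        refine (exists_extension_of_two_colours hn hG hc Finset.disjoint_sdiff hS.1.le
          ((Finset.card_le_card Finset.sdiff_subset).trans hB.1.le) ?_ (Finset.mem_sdiff.1 hs₁).1
          (Finset.mem_sdiff.1 hs₂).1 hs hb₁ hb₂ hb (by simpa using hX₁) (by simpa using hX₂)
          hY₁ hY₂).resolve_left ?_
        · intro b P hP hPO
          rcases Bool.eq_or_eq_not b a with rfl | rfl
          · exact hmeet hS hP fun x hx => (hPO x hx).1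
          · exact hmeet hB hP fun x hx => ((hmem x).1 (hPO x hx)).2
        · rintro ⟨Q, hQm, hQO⟩
          obtain ⟨o, ho, h⟩ := hQ Q hQm
          obtain ⟨p₁, p₂, p₃, p₄, p₅⟩ := hQO o ho
          exact p₅ (h p₁ p₂ p₃ p₄)
end
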